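/- arXiv:math-ph/0702052 — 2 statements merged into one kernel-verified Lean document; each statement's English description precedes it below -/
import Mathlib

section
/- Let p, q : ℝ → ℝ be smooth π-periodic functions with p ≥ 0, and suppose that either p(θ) > 0 for all θ, or p vanishes at exactly one point θ̂ of the period [0,π) and q(θ̂) ≠ 0. Then there exists exactly one smooth π-periodic function ρ : ℝ → ℝ with ρ ≥ 0, ∫₀^π ρ(θ)dθ = 1, and ∂_θ( ∂_θ(p·ρ) − q·ρ ) = 0 on ℝ. -/
noncomputable section

open Set Filter Topology

theorem exists_hasDerivAt_of_continuousOn {s : Set ℝ} (hs : IsOpen s) (hs' : s.OrdConnected)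
    {g : ℝ → ℝ} (hg : ContinuousOn g s) : ∃ G : ℝ → ℝ, ∀ x ∈ s, HasDerivAt G (g x) x := by
  rcases s.eq_empty_or_nonempty with rfl | ⟨x₀, hx₀⟩
  · exact ⟨0, by simp⟩
  · refine ⟨fun x => ∫ t in x₀..x, g t, fun x hx => ?_⟩
    exact intervalIntegral.integral_hasDerivAt_right
      ((hg.mono (hs'.uIcc_subset hx₀ hx)).intervalIntegrable)
      (hg.stronglyMeasurableAtFilter hs x hx) (hg.continuousAt (hs.mem_nhds hx))

/-- Solutions of `w' = b w + c` with smooth `b` are smooth. -/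
theorem contDiffOn_of_hasDerivAt_affine {s : Set ℝ} (hs : IsOpen s) {b w : ℝ → ℝ} {c : ℝ}
    (hb : ContDiffOn ℝ (⊤ : ℕ∞) b s) (hw : ∀ x ∈ s, HasDerivAt w (b x * w x + c) x) :
    ContDiffOn ℝ (⊤ : ℕ∞) w s := by
  rw [contDiffOn_infty]
  intro n
  induction n with
  | zero => exact contDiffOn_zero.2 fun x hx => (hw x hx).continuousAt.continuousWithinAt
  | succ n ih =>
    push_cast
    rw [contDiffOn_succ_iff_deriv_of_isOpen hs]
    refine ⟨fun x hx => (hw x hx).differentiableAt.differentiableWithinAt, by simp, ?_⟩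
    exact (((contDiffOn_infty.1 hb n).mul ih).add contDiffOn_const).congr
      fun x hx => (hw x hx).deriv

theorem monotoneOn_mul_exp {s : Set ℝ} (hs : Convex ℝ s)
    {z z' P P' : ℝ → ℝ} {k : ℝ} (hz : ∀ x ∈ s, HasDerivAt z (z' x) x)
    (hP : ∀ x ∈ s, HasDerivAt P (P' x) x) (h : ∀ x ∈ s, k * P' x * z x ≤ z' x) :
    MonotoneOn (fun x => z x * Real.exp (-(k * P x))) s := by
  have hd : ∀ x ∈ s, HasDerivAt (fun x => z x * Real.exp (-(k * P x)))
      ((z' x - k * P' x * z x) * Real.exp (-(k * P x))) x := fun x hx => by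
    refine ((hz x hx).mul (((hP x hx).const_mul k).neg.exp)).congr_deriv ?_
    simp only [Pi.neg_apply]
    ring
  refine monotoneOn_of_deriv_nonneg hs (fun x hx => (hd x hx).continuousAt.continuousWithinAt)
    (fun x hx => ?_) (fun x hx => ?_)
  · exact (hd x (interior_subset hx)).differentiableAt.differentiableWithinAt
  · rw [(hd x (interior_subset hx)).deriv]
    have := h x (interior_subset hx)
    exact mul_nonneg (by linarith) (Real.exp_pos _).le

/-- If `p z' ≥ k z` to the right of a zero of `p`, then `z` is asymptotically nonpositive. -/
theorem eventually_le_right_of_mul_deriv_ge {p z z' : ℝ → ℝ} {k ε : ℝ} (hk : 0 < k) (hε : 0 < ε)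
    (hpc : ContinuousOn p (Ioo 0 ε)) (hp0 : ∀ x ∈ Ioo 0 ε, 0 < p x)
    (hpx : ∀ x ∈ Ioo 0 ε, p x ≤ x)
    (hz : ∀ x ∈ Ioo 0 ε, HasDerivAt z (z' x) x) (h : ∀ x ∈ Ioo 0 ε, k * z x ≤ p x * z' x)
    {η : ℝ} (hη : 0 < η) : ∀ᶠ x in 𝓝[>] 0, z x ≤ η := by
  obtain ⟨P, hP⟩ := exists_hasDerivAt_of_continuousOn isOpen_Ioo ordConnected_Ioo
    (hpc.inv₀ fun x hx => (hp0 x hx).ne')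
  have hm := monotoneOn_mul_exp (k := k) (convex_Ioo 0 ε) hz hP fun x hx => by
    have := h x hx
    rw [mul_right_comm, Pi.inv_apply, ← div_eq_mul_inv, div_le_iff₀ (hp0 x hx)]
    linarith
  have hl : MonotoneOn (fun x => P x - Real.log x) (Ioo 0 ε) := by
    have hd : ∀ x ∈ Ioo 0 ε, HasDerivAt (fun x => P x - Real.log x) ((p x)⁻¹ - x⁻¹) x :=
      fun x hx => (hP x hx).sub (Real.hasDerivAt_log hx.1.ne')
    refine monotoneOn_of_deriv_nonneg (convex_Ioo 0 ε)
      (fun x hx => (hd x hx).continuousAt.continuousWithinAt) (fun x hx => ?_) (fun x hx => ?_)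
    · exact (hd x (interior_subset hx)).differentiableAt.differentiableWithinAt
    · have hx := interior_subset hx
      rw [(hd x hx).deriv, sub_nonneg]
      exact inv_anti₀ (hp0 x hx) (hpx x hx)
  have hx₀ : ε / 2 ∈ Ioo 0 ε := ⟨by linarith, by linarith⟩
  set K := z (ε / 2) * Real.exp (-(k * P (ε / 2)))
  set K' := P (ε / 2) - Real.log (ε / 2)
  have hlim : Tendsto (fun x => |K| * Real.exp (k * (Real.log x + K'))) (𝓝[>] 0)
      (𝓝 (|K| * 0)) := by
    refine (Real.tendsto_exp_atBot.comp ?_).const_mul _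
    exact (tendsto_atBot_add_const_right _ _ Real.tendsto_log_nhdsGT_zero).const_mul_atBot hk
  rw [mul_zero] at hlim
  filter_upwards [hlim.eventually_le_const hη, Ioo_mem_nhdsGT hx₀.1] with x hx hx'
  have hxm : x ∈ Ioo 0 ε := ⟨hx'.1, hx'.2.trans hx₀.2⟩
  have h1 : z x * Real.exp (-(k * P x)) ≤ K := hm hxm hx₀ hx'.2.le
  have h2 : P x - Real.log x ≤ K' := hl hxm hx₀ hx'.2.le
  calc z x = z x * Real.exp (-(k * P x)) * Real.exp (k * P x) := by
        rw [mul_assoc, ← Real.exp_add]; simp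
    _ ≤ |K| * Real.exp (k * (Real.log x + K')) := by
        gcongr
        · exact h1.trans (le_abs_self K)
        · linarith
    _ ≤ η := hx

/-- If `p z' ≥ k z` to the left of a zero of `p` and `p² z` is bounded above, then `z ≤ 0`. -/
theorem nonpos_left_of_mul_deriv_ge {p p' z z' : ℝ → ℝ} {k ε M : ℝ} (hk : 0 < k)
    (hp : ∀ x ∈ Ioo (-ε) 0, HasDerivAt p (p' x) x) (hp0 : ∀ x ∈ Ioo (-ε) 0, 0 < p x)
    (hpx : ∀ x ∈ Ioo (-ε) 0, p x ≤ -x) (hp' : ∀ x ∈ Ioo (-ε) 0, -(k / 4) ≤ p' x)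
    (hz : ∀ x ∈ Ioo (-ε) 0, HasDerivAt z (z' x) x) (h : ∀ x ∈ Ioo (-ε) 0, k * z x ≤ p x * z' x)
    (hM : ∀ x ∈ Ioo (-ε) 0, p x ^ 2 * z x ≤ M) : ∀ x ∈ Ioo (-ε) 0, z x ≤ 0 := by
  intro x hx
  obtain ⟨P, hP⟩ := exists_hasDerivAt_of_continuousOn (s := Ioo (-ε) 0) isOpen_Ioo ordConnected_Ioo
    ((show ContinuousOn p (Ioo (-ε) 0) from
      fun x hx => (hp x hx).continuousAt.continuousWithinAt).inv₀ fun x hx => (hp0 x hx).ne')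
  have hm := monotoneOn_mul_exp (k := k) (convex_Ioo (-ε) 0) hz hP fun x hx => by
    have := h x hx
    rw [mul_right_comm, Pi.inv_apply, ← div_eq_mul_inv, div_le_iff₀ (hp0 x hx)]
    linarith
  have hq : ∀ x ∈ Ioo (-ε) 0, HasDerivAt (fun x => -(p x ^ 2)⁻¹)
      (2 * p' x / p x ^ 3) x := fun x hx => by
    have h0 := (hp0 x hx).ne'
    refine ((((hp x hx).pow 2).inv (pow_ne_zero 2 h0)).neg).congr_deriv ?_
    simp
    field_simp
  have hm2 := monotoneOn_mul_exp (k := k / 2) (convex_Ioo (-ε) 0) hq hP fun x hx => by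
    have h0 := hp0 x hx
    have h1 := hp' x hx
    have : k / 2 * p⁻¹ x * -(p x ^ 2)⁻¹ = -(k / 2) / p x ^ 3 := by
      simp only [Pi.inv_apply]; field_simp
    rw [this]
    gcongr
    linarith
  have hl : MonotoneOn (fun x => P x + Real.log (-x)) (Ioo (-ε) 0) := by
    have hd : ∀ x ∈ Ioo (-ε) 0, HasDerivAt (fun x => P x + Real.log (-x)) ((p x)⁻¹ + x⁻¹) x :=
      fun x hx => by
        refine ((hP x hx).add ((hasDerivAt_neg x).log (by linarith [hx.2]))).congr_deriv ?_
        simp [neg_div_neg_eq]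
    refine monotoneOn_of_deriv_nonneg (convex_Ioo (-ε) 0)
      (fun x hx => (hd x hx).continuousAt.continuousWithinAt) (fun x hx => ?_) (fun x hx => ?_)
    · exact (hd x (interior_subset hx)).differentiableAt.differentiableWithinAt
    · have hx := interior_subset hx
      rw [(hd x hx).deriv]
      have := inv_anti₀ (hp0 x hx) (hpx x hx)
      rw [inv_neg] at this
      linarith
  set K := -(p x ^ 2)⁻¹ * Real.exp (-(k / 2 * P x))
  set K' := P x + Real.log (-x)
  have hlog : Tendsto (fun y : ℝ => Real.log (-y)) (𝓝[<] 0) atBot := by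
    refine Real.tendsto_log_nhdsGT_zero.comp ?_
    simpa using tendsto_neg_nhdsLT (a := (0 : ℝ))
  have hlim : Tendsto (fun y => |M| * (-K * Real.exp (k / 2 * (Real.log (-y) + -K')))) (𝓝[<] 0)
      (𝓝 (|M| * (-K * 0))) := by
    refine ((Real.tendsto_exp_atBot.comp ?_).const_mul _).const_mul _
    exact (tendsto_atBot_add_const_right _ _ hlog).const_mul_atBot (by positivity)
  rw [mul_zero, mul_zero] at hlim
  have key : z x * Real.exp (-(k * P x)) ≤ 0 := by
    refine ge_of_tendsto hlim ?_
    filter_upwards [Ioo_mem_nhdsLT hx.2] with y hy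
    have hym : y ∈ Ioo (-ε) 0 := ⟨hx.1.trans hy.1, hy.2⟩
    have h0 := hp0 y hym
    have h1 : z x * Real.exp (-(k * P x)) ≤ z y * Real.exp (-(k * P y)) := hm hx hym hy.1.le
    have h2 : K ≤ -(p y ^ 2)⁻¹ * Real.exp (-(k / 2 * P y)) := hm2 hx hym hy.1.le
    have h3 : K' ≤ P y + Real.log (-y) := hl hx hym hy.1.le
    refine h1.trans ?_
    calc z y * Real.exp (-(k * P y))
        = (p y ^ 2 * z y) * (((p y ^ 2)⁻¹ * Real.exp (-(k / 2 * P y)))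
            * Real.exp (-(k / 2 * P y))) := by
          rw [mul_assoc ((p y ^ 2)⁻¹), ← Real.exp_add]
          field_simp
          ring_nf
      _ ≤ |M| * (-K * Real.exp (k / 2 * (Real.log (-y) + -K'))) := by
          have hK : 0 ≤ -K := by simp only [K, neg_mul, neg_neg]; positivity
          gcongr
          · exact (hM y hym).trans (le_abs_self M)
          · linarith
          · linear_combination k / 2 * h3
  exact nonpos_of_mul_nonpos_left key (Real.exp_pos _)

/-- A bounded solution of `p v' = a v + f` near a degenerate zero of `p ≥ 0` has a limit there;
boundedness is only needed on the unstable side, where it may be relaxed to that of `p v`. -/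
theorem tendsto_of_degenerate_ode {p a f v : ℝ → ℝ} (hp : ContDiff ℝ (⊤ : ℕ∞) p)
    (hp0 : p 0 = 0) (hp0' : deriv p 0 = 0) (hpos : ∀ᶠ x in 𝓝[≠] 0, 0 < p x)
    (ha : ContinuousAt a 0) (ha0 : 0 < a 0) (hf : ContinuousAt f 0)
    (hv : ∀ᶠ x in 𝓝[≠] 0, HasDerivAt v ((a x * v x + f x) / p x) x)
    (hb : ∃ M, ∀ᶠ x in 𝓝[<] 0, |p x * v x| ≤ M) :
    Tendsto v (𝓝[≠] 0) (𝓝 (-f 0 / a 0)) := by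
  set L := -f 0 / a 0 with hL
  obtain ⟨k, hk, hka⟩ : ∃ k, 0 < k ∧ k < a 0 := exists_between ha0
  have hpd : Differentiable ℝ p := hp.differentiable (by simp)
  suffices H : ∀ η > 0, ∀ᶠ x in 𝓝[≠] 0, (v x - L) ^ 2 - η ≤ η by
    rw [Metric.tendsto_nhds]
    intro e he
    filter_upwards [H (e ^ 2 / 8) (by positivity)] with x hx
    rw [Real.dist_eq]
    refine abs_lt_of_sq_lt_sq ?_ he.le
    nlinarith [pow_pos he 2]
  intro η hη
  have e1 : ∀ᶠ x in 𝓝 0, |p x| ≤ |x| := by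
    have := (hpd 0).hasDerivAt
    rw [hp0', hasDerivAt_iff_isLittleO] at this
    simpa [hp0] using this.bound one_pos
  have e2 : ∀ᶠ x in 𝓝 0, -(k / 4) ≤ deriv p x := by
    refine (hp.continuous_deriv (by simp)).continuousAt.eventually_const_le ?_
    rw [hp0']; linarith
  have e3 : ∀ᶠ x in 𝓝 0, k ≤ a x := ha.eventually_const_le hka
  have e4 : ∀ᶠ x in 𝓝 0, (f x + a x * L) ^ 2 ≤ k ^ 2 * η := by
    have : ContinuousAt (fun x => (f x + a x * L) ^ 2) 0 := by fun_prop
    refine this.eventually_le_const ?_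
    have : f 0 + a 0 * L = 0 := by rw [hL]; field_simp; ring
    show (f 0 + a 0 * L) ^ 2 < k ^ 2 * η
    rw [this, zero_pow two_ne_zero]; positivity
  have e5 : ∀ᶠ x in 𝓝 (0 : ℝ), p x ≤ 1 :=
    hpd.continuous.continuousAt.eventually_le_const (by rw [hp0]; exact one_pos)
  have E : ∀ᶠ x in 𝓝[≠] 0, HasDerivAt v ((a x * v x + f x) / p x) x ∧ 0 < p x ∧ p x ≤ |x| ∧
      -(k / 4) ≤ deriv p x ∧ k ≤ a x ∧ (f x + a x * L) ^ 2 ≤ k ^ 2 * η ∧ p x ≤ 1 := by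
    filter_upwards [hv, hpos, nhdsWithin_le_nhds (e1.and (e2.and (e3.and (e4.and e5))))]
      with x h1 h2 ⟨h3, h4, h5, h6, h7⟩
    exact ⟨h1, h2, (le_abs_self _).trans h3, h4, h5, h6, h7⟩
  have hz : ∀ x, HasDerivAt v ((a x * v x + f x) / p x) x →
      HasDerivAt (fun x => (v x - L) ^ 2 - η) (2 * (v x - L) * ((a x * v x + f x) / p x)) x :=
    fun x hx => (((hx.sub_const L).pow 2).sub_const η).congr_deriv (by simp)
  have hineq : ∀ x, 0 < p x → k ≤ a x → (f x + a x * L) ^ 2 ≤ k ^ 2 * η →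
      k * ((v x - L) ^ 2 - η) ≤ p x * (2 * (v x - L) * ((a x * v x + f x) / p x)) := by
    intro x h1 h2 h3
    have : p x * (2 * (v x - L) * ((a x * v x + f x) / p x)) =
        2 * a x * (v x - L) ^ 2 + 2 * (v x - L) * (f x + a x * L) := by
      field_simp; ring
    rw [this]
    refine le_of_mul_le_mul_left ?_ hk
    nlinarith [sq_nonneg (k * (v x - L) + (f x + a x * L)),
      mul_nonneg (mul_nonneg hk.le (sub_nonneg.2 h2)) (sq_nonneg (v x - L))]
  rw [← nhdsLT_sup_nhdsGT, eventually_sup]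
  constructor
  · obtain ⟨M, hM⟩ := hb
    obtain ⟨l, hl, hs⟩ := mem_nhdsLT_iff_exists_Ioo_subset.1
      ((E.filter_mono (nhdsWithin_mono _ fun x (hx : x < 0) => hx.ne)).and hM)
    rw [← neg_neg l] at hs hl
    have := nonpos_left_of_mul_deriv_ge (ε := -l) (M := 2 * M ^ 2 + 2 * L ^ 2) hk
      (fun x _ => (hpd x).hasDerivAt) (fun x hx => (hs hx).1.2.1)
      (fun x hx => by simpa [abs_of_neg hx.2] using (hs hx).1.2.2.1)
      (fun x hx => (hs hx).1.2.2.2.1) (fun x hx => hz x (hs hx).1.1)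
      (fun x hx => hineq x (hs hx).1.2.1 (hs hx).1.2.2.2.2.1 (hs hx).1.2.2.2.2.2.1)
      (fun x hx => by
        have h1 := (hs hx).1.2.1
        have h2 := (hs hx).1.2.2.2.2.2.2
        have h3 : (p x * v x) ^ 2 ≤ M ^ 2 := sq_le_sq' (abs_le.1 (hs hx).2).1 (abs_le.1 (hs hx).2).2
        have h4 : p x ^ 2 * L ^ 2 ≤ 1 * L ^ 2 := by gcongr; exact pow_le_one₀ h1.le h2
        nlinarith [sq_nonneg (p x * v x + p x * L), mul_nonneg (sq_nonneg (p x)) hη.le])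
    filter_upwards [Ioo_mem_nhdsLT hl] with x hx
    exact (this x hx).trans hη.le
  · obtain ⟨l, hl, hs⟩ := mem_nhdsGT_iff_exists_Ioo_subset.1
      (E.filter_mono (nhdsWithin_mono _ fun x (hx : 0 < x) => hx.ne'))
    exact eventually_le_right_of_mul_deriv_ge hk hl hpd.continuous.continuousOn
      (fun x hx => (hs hx).2.1) (fun x hx => by simpa [abs_of_pos hx.1] using (hs hx).2.2.1)
      (fun x hx => hz x (hs hx).1)
      (fun x hx => hineq x (hs hx).2.1 (hs hx).2.2.2.2.1 (hs hx).2.2.2.2.2.1) hη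

theorem eventually_nhdsNE_eventually_nhds {a : ℝ} {s : ℝ → Prop} (h : ∀ᶠ x in 𝓝[≠] a, s x) :
    ∀ᶠ x in 𝓝[≠] a, ∀ᶠ y in 𝓝 x, s y := by
  filter_upwards [eventually_eventually_nhdsWithin.2 h, self_mem_nhdsWithin] with x hx hxa
  rwa [isOpen_compl_singleton.nhdsWithin_eq hxa] at hx

theorem hasDerivAt_of_eventually_nhdsNE {f g : ℝ → ℝ} {a : ℝ}
    (h : ∀ᶠ x in 𝓝[≠] a, HasDerivAt f (g x) x) (hf : ContinuousAt f a) (hg : ContinuousAt g a) :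
    HasDerivAt f (g a) a := by
  have hd : ∀ᶠ x in 𝓝[≠] a, DifferentiableWithinAt ℝ f {x | DifferentiableAt ℝ f x} x :=
    h.mono fun x hx => hx.differentiableAt.differentiableWithinAt
  have hdiff : DifferentiableOn ℝ f {x | DifferentiableAt ℝ f x} := fun x hx =>
    DifferentiableAt.differentiableWithinAt hx
  have hlim : Tendsto (deriv f) (𝓝[≠] a) (𝓝 (g a)) :=
    (hg.tendsto.mono_left nhdsWithin_le_nhds).congr' (h.mono fun x hx => hx.deriv.symm)
  have hmem : {x | DifferentiableAt ℝ f x} ∈ 𝓝[≠] a := h.mono fun x hx => hx.differentiableAt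
  have hr : 𝓝[>] a ≤ 𝓝[≠] a := nhdsWithin_mono _ fun x (hx : a < x) => hx.ne'
  have hl : 𝓝[<] a ≤ 𝓝[≠] a := nhdsWithin_mono _ fun x (hx : x < a) => hx.ne
  have := (hasDerivWithinAt_Iic_of_tendsto_deriv hdiff hf.continuousWithinAt (hl hmem)
    (hlim.mono_left hl)).union (hasDerivWithinAt_Ici_of_tendsto_deriv hdiff hf.continuousWithinAt
    (hr hmem) (hlim.mono_left hr))
  rwa [Iic_union_Ici, hasDerivWithinAt_univ] at this

theorem ContDiffAt.deriv_right_nat {f : ℝ → ℝ} {x : ℝ} {n : ℕ}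
    (h : ContDiffAt ℝ ((n + 1 : ℕ) : ℕ∞) f x) : ContDiffAt ℝ (n : ℕ∞) (deriv f) x :=
  (h.fderiv_right (m := (n : ℕ∞)) (by norm_cast)).clm_apply contDiffAt_const

/-- Solutions of `p v' = a v + f` near a degenerate zero of `p ≥ 0` extend smoothly through it,
unless they blow up on the unstable side. -/
theorem exists_contDiffAt_eventuallyEq_of_degenerate_ode {p : ℝ → ℝ}
    (hp : ContDiff ℝ (⊤ : ℕ∞) p)
    (hp0 : p 0 = 0) (hp0' : deriv p 0 = 0) (hpos : ∀ᶠ x in 𝓝[≠] 0, 0 < p x) (n : ℕ)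
    {a f v : ℝ → ℝ} (ha : ContDiff ℝ (⊤ : ℕ∞) a) (ha0 : 0 < a 0)
    (hf : ContDiffAt ℝ (n : ℕ∞) f 0)
    (hv : ∀ᶠ x in 𝓝[≠] 0, HasDerivAt v ((a x * v x + f x) / p x) x)
    (hb : ∃ M, ∀ᶠ x in 𝓝[<] 0, |p x * v x| ≤ M) :
    ∃ g, ContDiffAt ℝ (n : ℕ∞) g 0 ∧ v =ᶠ[𝓝[≠] 0] g := by
  have hlt : 𝓝[<] (0 : ℝ) ≤ 𝓝[≠] 0 := nhdsWithin_mono _ fun x (hx : x < 0) => hx.ne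
  induction n generalizing a f v with
  | zero =>
    have hlim := tendsto_of_degenerate_ode hp hp0 hp0' hpos ha.continuous.continuousAt ha0
      hf.continuousAt hv hb
    have hev : v =ᶠ[𝓝[≠] 0] Function.update v 0 (-f 0 / a 0) := by
      filter_upwards [self_mem_nhdsWithin] with x hx
      rw [Function.update_of_ne hx]
    refine ⟨Function.update v 0 (-f 0 / a 0), ?_, hev⟩
    refine contDiffAt_zero.2 ⟨_, eventually_nhdsWithin_iff.1
      (hv.and (eventually_nhdsNE_eventually_nhds hev)), fun x hx => ?_⟩
    rcases eq_or_ne x 0 with rfl | h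
    · exact (continuousAt_update_same.2 hlim).continuousWithinAt
    · exact ((hx h).1.continuousAt.congr (hx h).2).continuousWithinAt
  | succ n ih =>
    have hlim := tendsto_of_degenerate_ode hp hp0 hp0' hpos ha.continuous.continuousAt ha0
      hf.continuousAt hv hb
    obtain ⟨g, hg, hvg⟩ := ih ha ha0 (hf.of_le (by norm_cast; simp)) hv hb
    have hpd : Differentiable ℝ p := hp.differentiable (by simp)
    have had : Differentiable ℝ a := ha.differentiable (by simp)
    have hfd : ∀ᶠ x in 𝓝 0, DifferentiableAt ℝ f x :=
      ((hf.of_le (m := 1) (by norm_cast; simp)).eventually (by simp)).mono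
        fun x hx => hx.differentiableAt (by simp)
    obtain ⟨g₁, hg₁, hvg₁⟩ := ih (a := fun x => a x - deriv p x)
      (f := fun x => deriv a x * g x + deriv f x) (v := fun x => (a x * v x + f x) / p x)
      (ha.sub (contDiff_infty_iff_deriv.1 hp).2) (by simpa [hp0'] using ha0)
      ((((contDiff_infty_iff_deriv.1 ha).2.contDiffAt.of_le (mod_cast le_top)).mul hg).add
        hf.deriv_right_nat)
      (by
        filter_upwards [hv, hvg, hpos, nhdsWithin_le_nhds hfd] with x h1 h2 h3 h4
        refine ((((had x).hasDerivAt.mul h1).add h4.hasDerivAt).div (hpd x).hasDerivAt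
          h3.ne').congr_deriv ?_
        rw [← h2]
        simp only [Pi.add_apply, Pi.mul_apply]
        field_simp
        ring)
      (by
        have hc : Tendsto (fun x => |a x * v x + f x|) (𝓝[≠] 0)
            (𝓝 |a 0 * (-f 0 / a 0) + f 0|) :=
          (((ha.continuous.continuousAt.tendsto.mono_left nhdsWithin_le_nhds).mul hlim).add
            (hf.continuousAt.tendsto.mono_left nhdsWithin_le_nhds)).abs
        refine ⟨|a 0 * (-f 0 / a 0) + f 0| + 1, ?_⟩
        filter_upwards [hlt (hc.eventually_le_const (lt_add_one _)), hlt hpos] with x h1 h2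
        rwa [mul_div_cancel₀ _ h2.ne'])
    have hgd : ∀ᶠ x in 𝓝[≠] 0, HasDerivAt g (g₁ x) x := by
      filter_upwards [hv, hvg₁, eventually_nhdsNE_eventually_nhds hvg] with x h1 h2 h3
      rw [← h2]
      exact h1.congr_of_eventuallyEq (h3.mono fun y hy => hy.symm)
    refine ⟨g, ?_, hvg⟩
    push_cast
    refine contDiffAt_succ_iff_hasFDerivAt.2
      ⟨fun x => ContinuousLinearMap.toSpanSingleton ℝ (g₁ x), ⟨_, eventually_nhdsWithin_iff.1 hgd,
        fun x hx => ?_⟩, ?_⟩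
    · rcases eq_or_ne x 0 with rfl | h
      · exact (hasDerivAt_of_eventually_nhdsNE hgd hg.continuousAt hg₁.continuousAt).hasFDerivAt
      · exact (hx h).hasFDerivAt
    · exact (ContinuousLinearMap.toSpanSingletonCLE (𝕜 := ℝ)).contDiff.contDiffAt.comp _ hg₁

theorem contDiffAt_of_degenerate_ode {p a f v : ℝ → ℝ} (hp : ContDiff ℝ (⊤ : ℕ∞) p)
    (hp0 : p 0 = 0) (hp0' : deriv p 0 = 0) (hpos : ∀ᶠ x in 𝓝[≠] 0, 0 < p x)
    (ha : ContDiff ℝ (⊤ : ℕ∞) a) (ha0 : 0 < a 0) (hf : ContDiffAt ℝ (⊤ : ℕ∞) f 0)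
    (hv : ∀ᶠ x in 𝓝[≠] 0, HasDerivAt v ((a x * v x + f x) / p x) x)
    (hb : ∃ M, ∀ᶠ x in 𝓝[<] 0, |p x * v x| ≤ M) (hv0 : v 0 = -f 0 / a 0) :
    ContDiffAt ℝ (⊤ : ℕ∞) v 0 := by
  refine contDiffAt_infty.2 fun n => ?_
  obtain ⟨g, hg, hvg⟩ := exists_contDiffAt_eventuallyEq_of_degenerate_ode hp hp0 hp0' hpos n ha ha0
    (contDiffAt_infty.1 hf n) hv hb
  have hlim := tendsto_of_degenerate_ode hp hp0 hp0' hpos ha.continuous.continuousAt ha0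
    hf.continuousAt hv hb
  have hg0 : g 0 = v 0 := by
    rw [hv0]
    exact tendsto_nhds_unique (hg.continuousAt.tendsto.mono_left nhdsWithin_le_nhds)
      (hlim.congr' hvg)
  refine hg.congr_of_eventuallyEq ?_
  filter_upwards [eventually_nhdsWithin_iff.1 hvg] with x hx
  rcases eq_or_ne x 0 with rfl | h
  · exact hg0.symm
  · exact hx h

/-- If `b` is nonnegative near `r`, then `u' = b u - 1` has a positive solution on `(l, r)` which
stays bounded near `r`. -/
theorem exists_pos_hasDerivAt_bounded {b : ℝ → ℝ} {l r : ℝ} (hlr : l < r)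
    (hb : ContinuousOn b (Ioo l r)) (hb0 : ∀ᶠ x in 𝓝[<] r, 0 ≤ b x) :
    ∃ u : ℝ → ℝ, (∀ x ∈ Ioo l r, HasDerivAt u (b x * u x - 1) x ∧ 0 < u x) ∧
      ∃ M, ∀ᶠ x in 𝓝[<] r, u x ≤ M := by
  obtain ⟨B, hB⟩ := exists_hasDerivAt_of_continuousOn isOpen_Ioo ordConnected_Ioo hb
  have hBc : ContinuousOn B (Ioo l r) := fun x hx => (hB x hx).continuousAt.continuousWithinAt
  obtain ⟨J, hJ⟩ := exists_hasDerivAt_of_continuousOn isOpen_Ioo ordConnected_Ioo hBc.neg.rexp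
  simp only [Pi.neg_apply] at hJ
  have hJm : StrictMonoOn J (Ioo l r) := by
    refine strictMonoOn_of_deriv_pos (convex_Ioo l r)
      (fun x hx => (hJ x hx).continuousAt.continuousWithinAt) fun x hx => ?_
    rw [(hJ x (interior_subset hx)).deriv]
    exact Real.exp_pos _
  obtain ⟨m, hm, hs⟩ := mem_nhdsLT_iff_exists_Ioo_subset.1
    (hb0.and (Ioo_mem_nhdsLT hlr))
  have hBm : MonotoneOn B (Ioo m r) := by
    refine monotoneOn_of_deriv_nonneg (convex_Ioo m r) (hBc.mono fun x hx => (hs hx).2)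
      (fun x hx => ?_) fun x hx => ?_
    · exact (hB x (hs (interior_subset hx)).2).differentiableAt.differentiableWithinAt
    · rw [(hB x (hs (interior_subset hx)).2).deriv]
      exact (hs (interior_subset hx)).1
  have hJle : ∀ x ∈ Ioo m r, ∀ y ∈ Ioo l r, J y ≤ J x + Real.exp (-B x) * (r - l) := by
    intro x hx y hy
    have hxl := (hs hx).2
    have h0 := (Real.exp_pos (-B x)).le
    rcases le_total y x with h | h
    · have := hJm.monotoneOn hy hxl h
      nlinarith [hlr]
    · have hsub : Icc x y ⊆ Ioo m r := fun z hz => ⟨hx.1.trans_le hz.1, hz.2.trans_lt hy.2⟩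
      have hd : ∀ z ∈ Icc x y, HasDerivAt J (Real.exp (-B z)) z :=
        fun z hz => hJ z (hs (hsub hz)).2
      have := (convex_Icc x y).image_sub_le_mul_sub_of_deriv_le
        (fun z hz => (hd z hz).continuousAt.continuousWithinAt)
        (fun z hz => (hd z (interior_subset hz)).differentiableAt.differentiableWithinAt)
        (C := Real.exp (-B x)) (fun z hz => by
          have hz := interior_subset hz
          rw [(hd z hz).deriv]
          exact Real.exp_le_exp.2 (neg_le_neg (hBm hx (hsub hz) hz.1)))
        x (left_mem_Icc.2 h) y (right_mem_Icc.2 h) h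
      have h2 : y - x ≤ r - l := by linarith [hy.2, hxl.1]
      nlinarith
  obtain ⟨x₀, hx₀⟩ := nonempty_Ioo.2 (mem_Iio.1 hm)
  have hbdd : BddAbove (J '' Ioo l r) := ⟨_, forall_mem_image.2 (hJle x₀ hx₀)⟩
  set L := sSup (J '' Ioo l r)
  have hlt : ∀ x ∈ Ioo l r, J x < L := fun x hx => by
    obtain ⟨y, hy⟩ := nonempty_Ioo.2 hx.2
    have hy' : y ∈ Ioo l r := ⟨hx.1.trans hy.1, hy.2⟩
    exact (hJm hx hy' hy.1).trans_le (le_csSup hbdd (mem_image_of_mem _ hy'))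
  refine ⟨fun x => Real.exp (B x) * (L - J x), fun x hx => ⟨?_, ?_⟩, r - l, ?_⟩
  · refine ((hB x hx).exp.mul ((hJ x hx).const_sub L)).congr_deriv ?_
    have : Real.exp (B x) * Real.exp (-B x) = 1 := by rw [← Real.exp_add]; simp
    linear_combination -this
  · exact mul_pos (Real.exp_pos _) (sub_pos.2 (hlt x hx))
  · filter_upwards [Ioo_mem_nhdsLT hm] with x hx
    have : L ≤ J x + Real.exp (-B x) * (r - l) :=
      csSup_le ((nonempty_Ioo.2 hlr).image J) (forall_mem_image.2 (hJle x hx))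
    calc Real.exp (B x) * (L - J x) ≤ Real.exp (B x) * (Real.exp (-B x) * (r - l)) := by
          gcongr; linarith
      _ = r - l := by rw [← mul_assoc, ← Real.exp_add]; simp

/-- `ρ` is a smooth `π`-periodic function whose flux `(pρ)' - qρ` is constant. -/
def IsStationaryDensity (p q ρ : ℝ → ℝ) : Prop :=
  ContDiff ℝ (⊤ : ℕ∞) ρ ∧ Function.Periodic ρ Real.pi ∧
    ∃ c, ∀ x, HasDerivAt (fun y => p y * ρ y) (q x * ρ x + c) x

/-- There is a nonzero nonnegative stationary density, and stationary densities are determined by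
their value at a suitable point. -/
def HasGroundstateRay (p q : ℝ → ℝ) : Prop :=
  (∃ t, ∀ σ, IsStationaryDensity p q σ → σ t = 0 → σ = 0) ∧
    ∃ ρ, IsStationaryDensity p q ρ ∧ (∀ x, 0 ≤ ρ x) ∧ ρ ≠ 0

theorem IsStationaryDensity.linear_comb {p q ρ σ : ℝ → ℝ} (hρ : IsStationaryDensity p q ρ)
    (hσ : IsStationaryDensity p q σ) (α β : ℝ) :
    IsStationaryDensity p q (fun x => α * ρ x - β * σ x) := by
  obtain ⟨hρs, hρp, c, hc⟩ := hρ
  obtain ⟨hσs, hσp, d, hd⟩ := hσ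
  refine ⟨(contDiff_const.mul hρs).sub (contDiff_const.mul hσs),
    fun x => by simp only [hρp x, hσp x],
    α * c - β * d, fun x => ?_⟩
  have hflux : (fun y => p y * (α * ρ y - β * σ y)) =
      (fun y => α * (p y * ρ y)) - fun y => β * (p y * σ y) :=
    funext fun y => by simp only [Pi.sub_apply]; ring
  rw [hflux]
  exact (((hc x).const_mul α).sub ((hd x).const_mul β)).congr_deriv (by ring)

theorem IsStationaryDensity.comp_isometry {p q ρ : ℝ → ℝ} (h : IsStationaryDensity p q ρ) {s : ℝ}
    (hs : s = 1 ∨ s = -1) (t : ℝ) :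
    IsStationaryDensity (fun x => p (s * x + t)) (fun x => s * q (s * x + t))
      (fun x => ρ (s * x + t)) := by
  obtain ⟨hρs, hρp, c, hc⟩ := h
  have hlin : ∀ x, HasDerivAt (fun x => s * x + t) s x := fun x =>
    (((hasDerivAt_id x).const_mul s).add_const t).congr_deriv (by simp)
  refine ⟨hρs.comp (by fun_prop), fun x => ?_, s * c, fun x => ?_⟩
  · rcases hs with rfl | rfl
    · beta_reduce; rw [← hρp (1 * x + t)]; ring_nf
    · beta_reduce; rw [← hρp (-1 * (x + Real.pi) + t)]; ring_nf
  · have := (hc (s * x + t)).comp x (hlin x)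
    exact this.congr_deriv (by ring)

theorem HasGroundstateRay.of_comp_isometry {p q : ℝ → ℝ} {s t : ℝ} (hs : s = 1 ∨ s = -1)
    (h : HasGroundstateRay (fun x => p (s * x + t)) (fun x => s * q (s * x + t))) :
    HasGroundstateRay p q := by
  obtain ⟨⟨t₀, hu⟩, ρ, hρ, hρ0, hρne⟩ := h
  have hss : s * s = 1 := by rcases hs with rfl | rfl <;> norm_num
  have hinv : ∀ x, s * (s * x + -(s * t)) + t = x := fun x => by linear_combination (x - t) * hss
  have hinv' : ∀ x, s * (s * x + t) + -(s * t) = x := fun x => by linear_combination x * hss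
  refine ⟨⟨s * t₀ + t, fun σ hσ h0 => ?_⟩, fun x => ρ (s * x + -(s * t)), ?_, fun x => hρ0 _, ?_⟩
  · have := hu _ (hσ.comp_isometry hs t) h0
    ext y
    simpa [hinv] using congrFun this (s * y + -(s * t))
  · have := hρ.comp_isometry hs (-(s * t))
    simpa only [hinv, ← mul_assoc, hss, one_mul] using this
  · intro h
    apply hρne
    ext y
    simpa [hinv'] using congrFun h (s * y + t)

theorem hasGroundstateRay_of_pos {p q : ℝ → ℝ}
    (hp : ContDiff ℝ (⊤ : ℕ∞) p) (hq : ContDiff ℝ (⊤ : ℕ∞) q)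
    (hpper : Function.Periodic p Real.pi) (hqper : Function.Periodic q Real.pi)
    (hpos : ∀ x, 0 < p x) : HasGroundstateRay p q := by
  have hbs : ContDiff ℝ (⊤ : ℕ∞) (fun x => q x / p x) := hq.div hp fun x => (hpos x).ne'
  obtain ⟨B, hB⟩ := exists_hasDerivAt_of_continuousOn isOpen_univ ordConnected_univ
    hbs.continuous.continuousOn
  simp only [mem_univ, true_implies] at hB
  have hBc : Continuous B := continuous_iff_continuousAt.2 fun x => (hB x).continuousAt
  have hE : ∀ x, HasDerivAt (fun x => Real.exp (-B x)) (-(q x / p x) * Real.exp (-B x)) x :=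
    fun x => (hB x).neg.exp.congr_deriv (by simp only [Pi.neg_apply]; ring)
  constructor
  · refine ⟨0, fun σ ⟨hσs, hσp, c, hc⟩ h0 => ?_⟩
    have hh : ∀ x, HasDerivAt (fun x => p x * σ x * Real.exp (-B x)) (c * Real.exp (-B x)) x := by
      intro x
      refine ((hc x).mul (hE x)).congr_deriv ?_
      have := (hpos x).ne'
      field_simp
      ring
    obtain ⟨y, -, hy⟩ := exists_hasDerivAt_eq_zero Real.pi_pos
      (fun x _ => (hh x).continuousAt.continuousWithinAt)
      (by have := hσp 0; rw [zero_add] at this; simp [this, h0]) fun x _ => hh x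
    have hc0 : c = 0 := by simpa using hy
    ext x
    have := is_const_of_deriv_eq_zero (fun x => (hh x).differentiableAt)
      (fun x => by rw [(hh x).deriv, hc0, zero_mul]) x 0
    simpa [h0, (hpos x).ne'] using this
  · obtain ⟨J, hJ⟩ := exists_hasDerivAt_of_continuousOn isOpen_univ ordConnected_univ
      (g := fun x => Real.exp (-B x)) (by fun_prop)
    simp only [mem_univ, true_implies] at hJ
    have hJm : StrictMono J := strictMono_of_deriv_pos fun x => by
      rw [(hJ x).deriv]; exact Real.exp_pos _
    have hBsh : ∀ x, HasDerivAt (fun x => B (x + Real.pi)) (q x / p x) x := fun x => by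
      have := (hB (x + Real.pi)).comp_add_const x Real.pi
      rwa [hpper, hqper] at this
    obtain ⟨K, hK⟩ : ∃ K, ∀ x, B (x + Real.pi) = B x + K := by
      refine ⟨B (0 + Real.pi) - B 0, fun x => ?_⟩
      have := is_const_of_deriv_eq_zero (f := fun x => B (x + Real.pi) - B x)
        (fun x => ((hBsh x).sub (hB x)).differentiableAt)
        (fun x => ((hBsh x).sub (hB x)).deriv.trans (sub_self _)) x 0
      linarith
    have hJsh : ∀ x, HasDerivAt (fun x => J (x + Real.pi)) (Real.exp (-K) * Real.exp (-B x)) x :=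
      fun x => by
        have := (hJ (x + Real.pi)).comp_add_const x Real.pi
        rwa [hK, neg_add_rev, Real.exp_add] at this
    have hJK : ∀ x, J (x + Real.pi + Real.pi) - J (x + Real.pi) =
        Real.exp (-K) * (J (x + Real.pi) - J x) := fun x => by
      have hd : ∀ x, HasDerivAt (fun x => J (x + Real.pi) - Real.exp (-K) * J x) 0 x := fun x =>
        ((hJsh x).sub ((hJ x).const_mul _)).congr_deriv (sub_self _)
      have := is_const_of_deriv_eq_zero (fun x => (hd x).differentiableAt) (fun x => (hd x).deriv)
        (x + Real.pi) x
      linarith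
    set u : ℝ → ℝ := fun x => Real.exp (B x) * (J (x + Real.pi) - J x) with hu
    have hupos : ∀ x, 0 < u x := fun x =>
      mul_pos (Real.exp_pos _) (sub_pos.2 (hJm (by linarith [Real.pi_pos])))
    have hud : ∀ x, HasDerivAt u (q x / p x * u x + (Real.exp (-K) - 1)) x := fun x => by
      refine ((hB x).exp.mul ((hJsh x).sub (hJ x))).congr_deriv ?_
      have : Real.exp (B x) * Real.exp (-B x) = 1 := by rw [← Real.exp_add]; simp
      simp only [hu, Pi.sub_apply]
      linear_combination (Real.exp (-K) - 1) * this
    have hus : ContDiff ℝ (⊤ : ℕ∞) u := contDiffOn_univ.1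
      (contDiffOn_of_hasDerivAt_affine isOpen_univ hbs.contDiffOn fun x _ => hud x)
    have hup : Function.Periodic u Real.pi := fun x => by
      have : Real.exp K * Real.exp (-K) = 1 := by rw [← Real.exp_add]; simp
      simp only [hu]
      rw [hJK, hK, Real.exp_add]
      linear_combination Real.exp (B x) * (J (x + Real.pi) - J x) * this
    refine ⟨fun x => u x / p x, ⟨hus.div hp fun x => (hpos x).ne', fun x => ?_,
      Real.exp (-K) - 1, fun x => ?_⟩, fun x => (div_pos (hupos x) (hpos x)).le, fun h => ?_⟩
    · simp only [hup x, hpper x]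
    · have : (fun y => p y * (u y / p y)) = u := by
        ext y
        have := (hpos y).ne'
        field_simp
      rw [this]
      exact (hud x).congr_deriv (by ring)
    · exact (div_pos (hupos 0) (hpos 0)).ne' (congrFun h 0)

theorem eq_zero_of_isStationaryDensity_of_degenerate {p q σ : ℝ → ℝ}
    (hpd : Differentiable ℝ p) (hq : Continuous q)
    (hpper : Function.Periodic p Real.pi) (hqper : Function.Periodic q Real.pi)
    (hp0 : p 0 = 0) (hp0' : deriv p 0 = 0) (hpos : ∀ x ∈ Ioo 0 Real.pi, 0 < p x) (hq0 : 0 < q 0)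
    (hσ : IsStationaryDensity p q σ) (h0 : σ 0 = 0) : σ = 0 := by
  obtain ⟨hσs, hσp, c, hc⟩ := hσ
  have hpnn : ∀ x ∈ Icc 0 Real.pi, 0 ≤ p x := by
    rintro x ⟨h1, h2⟩
    rcases h1.eq_or_lt with rfl | h1
    · exact hp0.ge
    rcases h2.eq_or_lt with rfl | h2
    · rw [hpper.eq, hp0]
    · exact (hpos x ⟨h1, h2⟩).le
  have hσd : Differentiable ℝ σ := hσs.differentiable (by simp)
  have hc0 : c = 0 := by
    have := (hc 0).unique ((hpd 0).hasDerivAt.mul (hσd 0).hasDerivAt)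
    simpa [h0, hp0, hp0'] using this
  have hw : ∀ x, HasDerivAt (fun y => p y * σ y) (q x * σ x) x := fun x => by
    simpa [hc0] using hc x
  obtain ⟨B, hB⟩ := exists_hasDerivAt_of_continuousOn (s := Ioo 0 Real.pi) isOpen_Ioo
    ordConnected_Ioo (g := fun x => q x / p x)
    (hq.continuousOn.div hpd.continuous.continuousOn fun x hx => (hpos x hx).ne')
  have hh : ∀ x ∈ Ioo 0 Real.pi, HasDerivAt (fun y => p y * σ y * Real.exp (-B y)) 0 x := by
    intro x hx
    refine ((hw x).mul (hB x hx).neg.exp).congr_deriv ?_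
    have := (hpos x hx).ne'
    simp only [Pi.neg_apply]
    field_simp
    ring
  have hqπ : ∀ᶠ x in 𝓝[<] Real.pi, 0 ≤ q x := nhdsWithin_le_nhds
    (hq.continuousAt.eventually_const_le (by rwa [hqper.eq]))
  obtain ⟨l, hl, hs⟩ := mem_nhdsLT_iff_exists_Ioo_subset.1
    (hqπ.and (Ioo_mem_nhdsLT Real.pi_pos))
  obtain ⟨m, hm⟩ := nonempty_Ioo.2 (mem_Iio.1 hl)
  have hmπ := (hs hm).2
  have hmono : MonotoneOn (fun y => (p y * σ y) ^ 2) (Icc m Real.pi) := by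
    refine monotoneOn_of_deriv_nonneg (convex_Icc _ _)
      (fun x _ => ((hw x).pow 2).continuousAt.continuousWithinAt)
      (fun x _ => ((hw x).pow 2).differentiableAt.differentiableWithinAt) fun x hx => ?_
    rw [interior_Icc] at hx
    have hx' := hs ⟨hm.1.trans hx.1, hx.2⟩
    have : deriv (fun y => (p y * σ y) ^ 2) x = 2 * (p x * q x) * σ x ^ 2 := by
      refine (((hw x).pow 2).congr_deriv ?_).deriv
      norm_num
      ring
    rw [this]
    have h1 := hpos x hx'.2
    have h2 := hx'.1
    positivity
  have hm0 : p m * σ m = 0 := by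
    have := hmono (left_mem_Icc.2 hmπ.2.le) (right_mem_Icc.2 hmπ.2.le) hmπ.2.le
    simp only [hpper.eq, hp0, zero_mul] at this
    exact pow_eq_zero_iff two_ne_zero |>.1 (le_antisymm (by simpa using this) (sq_nonneg _))
  ext x
  obtain ⟨y, ⟨hy0, hyπ⟩, hxy⟩ := hσp.exists_mem_Ico₀ Real.pi_pos x
  rw [hxy]
  rcases hy0.eq_or_lt with rfl | hy0
  · exact h0
  · have := isOpen_Ioo.is_const_of_deriv_eq_zero isPreconnected_Ioo
      (fun x hx => (hh x hx).differentiableAt.differentiableWithinAt)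
      (fun x hx => (hh x hx).deriv) ⟨hy0, hyπ⟩ hmπ
    simpa [hm0, (hpos y ⟨hy0, hyπ⟩).ne'] using this

theorem exists_isStationaryDensity_of_degenerate {p q : ℝ → ℝ}
    (hp : ContDiff ℝ (⊤ : ℕ∞) p) (hq : ContDiff ℝ (⊤ : ℕ∞) q)
    (hpper : Function.Periodic p Real.pi) (hqper : Function.Periodic q Real.pi)
    (hp0 : p 0 = 0) (hp0' : deriv p 0 = 0) (hpos : ∀ x ∈ Ioo 0 Real.pi, 0 < p x)
    (hq0 : 0 < q 0) :
    ∃ ρ, IsStationaryDensity p q ρ ∧ (∀ x, 0 ≤ ρ x) ∧ ρ ≠ 0 := by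
  have hpd : Differentiable ℝ p := hp.differentiable (by simp)
  have hbs : ContDiffOn ℝ (⊤ : ℕ∞) (fun x => q x / p x) (Ioo 0 Real.pi) :=
    hq.contDiffOn.div hp.contDiffOn fun x hx => (hpos x hx).ne'
  have hqπ : ∀ᶠ x in 𝓝[<] Real.pi, 0 ≤ q x / p x := by
    filter_upwards [Ioo_mem_nhdsLT Real.pi_pos, nhdsWithin_le_nhds
      (hq.continuous.continuousAt.eventually_const_le (by rwa [hqper.eq]))] with x h1 h2
    exact div_nonneg h2 (hpos x h1).le
  obtain ⟨u, hu, M, hM⟩ := exists_pos_hasDerivAt_bounded Real.pi_pos hbs.continuousOn hqπ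
  have hus := contDiffOn_of_hasDerivAt_affine isOpen_Ioo hbs fun x hx => (hu x hx).1
  obtain ⟨ρ, hρp, hρ0, hρu⟩ : ∃ ρ : ℝ → ℝ, Function.Periodic ρ Real.pi ∧ ρ 0 = 1 / q 0 ∧
      ∀ x ∈ Ioo 0 Real.pi, ρ x = u x / p x := by
    refine ⟨fun x => Function.update (fun y => u y / p y) 0 (1 / q 0) (toIcoMod Real.pi_pos 0 x),
      fun x => by simp only [toIcoMod_add_right], ?_, fun x hx => ?_⟩
    · simp
    · have : toIcoMod Real.pi_pos 0 x = x :=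
        (toIcoMod_eq_self Real.pi_pos).2 ⟨hx.1.le, by simpa using hx.2⟩
      simp only [this, Function.update_of_ne hx.1.ne']
  have hρev : ∀ x ∈ Ioo 0 Real.pi, ρ =ᶠ[𝓝 x] fun y => u y / p y := fun x hx => by
    filter_upwards [isOpen_Ioo.mem_nhds hx] with y hy using hρu y hy
  have hpos_left : ∀ x ∈ Ioo (-Real.pi) 0, x + Real.pi ∈ Ioo 0 Real.pi := fun x hx =>
    ⟨by linarith [hx.1], by linarith [hx.2]⟩
  have hposne : ∀ᶠ x in 𝓝[≠] 0, 0 < p x := by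
    rw [← nhdsLT_sup_nhdsGT, eventually_sup]
    refine ⟨?_, mem_of_superset (Ioo_mem_nhdsGT Real.pi_pos) hpos⟩
    filter_upwards [Ioo_mem_nhdsLT (neg_lt_zero.2 Real.pi_pos)] with x hx
    rw [← hpper]
    exact hpos _ (hpos_left x hx)
  have hp'per : ∀ x, deriv p (x + Real.pi) = deriv p x := fun x => by
    rw [← deriv_comp_add_const, hpper.funext]
  have hρd : ∀ x ∈ Ioo 0 Real.pi,
      HasDerivAt ρ (((q x - deriv p x) * ρ x + -1) / p x) x := fun x hx => by
    have h := (hpos x hx).ne'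
    refine (((hu x hx).1.div (hpd x).hasDerivAt h).congr_of_eventuallyEq (hρev x hx)).congr_deriv ?_
    rw [hρu x hx]
    field_simp
    ring
  have hρdne : ∀ᶠ x in 𝓝[≠] 0, HasDerivAt ρ (((q x - deriv p x) * ρ x + -1) / p x) x := by
    rw [← nhdsLT_sup_nhdsGT, eventually_sup]
    refine ⟨?_, mem_of_superset (Ioo_mem_nhdsGT Real.pi_pos) hρd⟩
    filter_upwards [Ioo_mem_nhdsLT (neg_lt_zero.2 Real.pi_pos)] with x hx
    have := (hρd _ (hpos_left x hx)).comp_add_const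
    rwa [hρp.funext, hqper, hp'per, hρp, hpper] at this
  have hbound : ∃ M, ∀ᶠ x in 𝓝[<] 0, |p x * ρ x| ≤ M := by
    refine ⟨M, ?_⟩
    have hshift : Tendsto (fun x => x + Real.pi) (𝓝[<] 0) (𝓝[<] Real.pi) := by
      refine tendsto_nhdsWithin_iff.2 ⟨?_, ?_⟩
      · have : Tendsto (fun x => x + Real.pi) (𝓝 0) (𝓝 (0 + Real.pi)) :=
          tendsto_id.add_const _
        rw [zero_add] at this
        exact this.mono_left nhdsWithin_le_nhds
      · filter_upwards [self_mem_nhdsWithin] with x (hx : x < 0)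
        simpa using hx
    filter_upwards [hshift.eventually hM, Ioo_mem_nhdsLT (neg_lt_zero.2 Real.pi_pos)] with x h1 hx
    have hx' := hpos_left x hx
    rw [← hpper, ← hρp, hρu _ hx', mul_div_cancel₀ _ (hpos _ hx').ne', abs_of_pos (hu _ hx').2]
    exact h1
  have hρ0s : ContDiffAt ℝ (⊤ : ℕ∞) ρ 0 := contDiffAt_of_degenerate_ode
    (a := fun x => q x - deriv p x) (f := fun _ => -1) hp hp0 hp0' hposne
    (hq.sub (contDiff_infty_iff_deriv.1 hp).2) (by simpa [hp0'] using hq0) contDiffAt_const hρdne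
    hbound (by simp [hρ0, hp0'])
  have hρs : ContDiff ℝ (⊤ : ℕ∞) ρ := by
    have hper : Function.Periodic (fun x => ContDiffAt ℝ (⊤ : ℕ∞) ρ x) Real.pi := fun x => by
      refine propext ⟨fun h => ?_, fun h => ?_⟩
      · have := ContDiffAt.comp x (f := fun y => y + Real.pi) (g := ρ) h (by fun_prop)
        rwa [show ρ ∘ (fun y => y + Real.pi) = ρ from hρp.funext] at this
      · have := ContDiffAt.comp (x + Real.pi) (f := fun y => y - Real.pi) (g := ρ)
          (by simpa using h) (by fun_prop)
        rwa [show ρ ∘ (fun y => y - Real.pi) = ρ from funext hρp.sub_eq] at this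
    refine contDiff_iff_contDiffAt.2 fun x => ?_
    obtain ⟨y, ⟨hy0, hyπ⟩, hxy⟩ := hper.exists_mem_Ico₀ Real.pi_pos x
    rw [hxy]
    rcases hy0.eq_or_lt with rfl | hy0
    · exact hρ0s
    · have hy : y ∈ Ioo 0 Real.pi := ⟨hy0, hyπ⟩
      exact ((hus.contDiffAt (isOpen_Ioo.mem_nhds hy)).div hp.contDiffAt
        (hpos y hy).ne').congr_of_eventuallyEq (hρev y hy)
  have hρdiff : Differentiable ℝ ρ := hρs.differentiable (by simp)
  refine ⟨ρ, ⟨hρs, hρp, -1, fun x => ?_⟩, fun x => ?_, fun h => ?_⟩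
  · have hflux : Function.Periodic
        (fun x => deriv p x * ρ x + p x * deriv ρ x - q x * ρ x) Real.pi := fun x => by
      have : deriv ρ (x + Real.pi) = deriv ρ x := by
        rw [← deriv_comp_add_const, hρp.funext]
      simp only [hp'per x, hρp x, hpper x, hqper x, this]
    refine ((hpd x).hasDerivAt.mul (hρdiff x).hasDerivAt).congr_deriv ?_
    rw [← sub_eq_iff_eq_add']
    obtain ⟨y, ⟨hy0, hyπ⟩, hxy⟩ := hflux.exists_mem_Ico₀ Real.pi_pos x
    refine hxy.trans ?_
    rcases hy0.eq_or_lt with rfl | hy0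
    · simp [hp0, hp0', hρ0, hq0.ne']
    · have hy : y ∈ Ioo 0 Real.pi := ⟨hy0, hyπ⟩
      simp only [(hρd y hy).deriv, mul_div_cancel₀ _ (hpos y hy).ne']
      ring
  · obtain ⟨y, ⟨hy0, hyπ⟩, hxy⟩ := hρp.exists_mem_Ico₀ Real.pi_pos x
    rw [hxy]
    rcases hy0.eq_or_lt with rfl | hy0
    · rw [hρ0]; positivity
    · have hy : y ∈ Ioo 0 Real.pi := ⟨hy0, hyπ⟩
      rw [hρu y hy]
      exact (div_pos (hu y hy).2 (hpos y hy)).le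
  · rw [h] at hρ0
    exact (one_div_pos.2 hq0).ne hρ0

theorem hasGroundstateRay_of_degenerate {p q : ℝ → ℝ}
    (hp : ContDiff ℝ (⊤ : ℕ∞) p) (hq : ContDiff ℝ (⊤ : ℕ∞) q)
    (hpper : Function.Periodic p Real.pi) (hqper : Function.Periodic q Real.pi)
    (hpnonneg : ∀ x, 0 ≤ p x) {t : ℝ} (hpt : p t = 0) (hqt : q t ≠ 0)
    (huniq : ∀ x ∈ Ico 0 Real.pi, p x = 0 → x = t) : HasGroundstateRay p q := by
  obtain ⟨s, hs, hsq⟩ : ∃ s : ℝ, (s = 1 ∨ s = -1) ∧ 0 < s * q t := by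
    rcases hqt.lt_or_gt with h | h
    · exact ⟨-1, Or.inr rfl, by linarith⟩
    · exact ⟨1, Or.inl rfl, by linarith⟩
  have hper : ∀ {f : ℝ → ℝ}, Function.Periodic f Real.pi →
      Function.Periodic (fun x => f (s * x + t)) Real.pi := fun {f} hf x => by
    rcases hs with rfl | rfl
    · beta_reduce; rw [← hf (1 * x + t)]; ring_nf
    · beta_reduce; rw [← hf (-1 * (x + Real.pi) + t)]; ring_nf
  have hpos : ∀ x ∈ Ioo 0 Real.pi, 0 < p (s * x + t) := by
    refine fun x hx => (hpnonneg _).lt_of_ne' fun h0 => ?_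
    have hmem := toIcoMod_mem_Ico' Real.pi_pos (s * x + t)
    have hn : toIcoMod Real.pi_pos 0 (s * x + t) = s * x + t -
        toIcoDiv Real.pi_pos 0 (s * x + t) * Real.pi := by
      rw [toIcoMod, zsmul_eq_mul]
    set n := toIcoDiv Real.pi_pos 0 (s * x + t)
    have h1 := huniq _ hmem (by rw [hn, hpper.sub_int_mul_eq, h0])
    have h2 : s * x = n * Real.pi := by linarith
    have h3 : |(n : ℝ)| * Real.pi = x := by
      rw [← abs_of_pos Real.pi_pos, ← abs_mul, ← h2, abs_mul, abs_of_pos hx.1]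
      rcases hs with rfl | rfl <;> simp
    have h4 : |(n : ℝ)| < 1 := by
      by_contra! h
      nlinarith [hx.2, Real.pi_pos]
    have h5 : n = 0 := Int.abs_lt_one_iff.1 (by exact_mod_cast h4)
    rw [h5] at h3
    simp at h3
    exact hx.1.ne h3
  have hpc : ContDiff ℝ (⊤ : ℕ∞) (fun x => p (s * x + t)) := hp.comp (by fun_prop)
  have hqc : ContDiff ℝ (⊤ : ℕ∞) (fun x => s * q (s * x + t)) :=
    contDiff_const.mul (hq.comp (by fun_prop))
  have hqp : Function.Periodic (fun x => s * q (s * x + t)) Real.pi := fun x => by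
    simp only [hper hqper x]
  have hp0 : p (s * 0 + t) = 0 := by simpa using hpt
  have hq0 : 0 < s * q (s * 0 + t) := by simpa using hsq
  have hmin : IsLocalMin (fun x => p (s * x + t)) 0 := Eventually.of_forall fun x => by
    simpa only [hp0] using hpnonneg _
  refine HasGroundstateRay.of_comp_isometry hs (t := t) ⟨⟨0, fun σ hσ h0 => ?_⟩, ?_⟩
  · exact eq_zero_of_isStationaryDensity_of_degenerate (hpc.differentiable (by simp)) hqc.continuous
      (hper hpper) hqp hp0 hmin.deriv_eq_zero hpos hq0 hσ h0
  · exact exists_isStationaryDensity_of_degenerate hpc hqc (hper hpper) hqp hp0 hmin.deriv_eq_zero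
      hpos hq0

theorem isStationaryDensity_iff {p q ρ : ℝ → ℝ} (hp : ContDiff ℝ (⊤ : ℕ∞) p)
    (hq : ContDiff ℝ (⊤ : ℕ∞) q) :
    IsStationaryDensity p q ρ ↔ ContDiff ℝ (⊤ : ℕ∞) ρ ∧ Function.Periodic ρ Real.pi ∧
      ∀ θ : ℝ, deriv (fun x => deriv (fun y => p y * ρ y) x - q x * ρ x) θ = 0 := by
  refine and_congr_right fun hρ => and_congr_right fun _ => ⟨fun ⟨c, hc⟩ θ => ?_, fun h => ?_⟩
  · have : (fun x => deriv (fun y => p y * ρ y) x - q x * ρ x) = fun _ => c := by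
      ext x
      rw [(hc x).deriv]
      ring
    rw [this, deriv_const]
  · have hpρ : ContDiff ℝ (⊤ : ℕ∞) (fun y => p y * ρ y) := hp.mul hρ
    have hflux : ContDiff ℝ (⊤ : ℕ∞) (fun x => deriv (fun y => p y * ρ y) x - q x * ρ x) :=
      (contDiff_infty_iff_deriv.1 hpρ).2.sub (hq.mul hρ)
    refine ⟨deriv (fun y => p y * ρ y) 0 - q 0 * ρ 0, fun x => ?_⟩
    have := is_const_of_deriv_eq_zero (hflux.differentiable (by simp)) h x 0
    refine ((hpρ.differentiable (by simp)) x).hasDerivAt.congr_deriv ?_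
    linarith

theorem integral_pos_of_periodic {ρ : ℝ → ℝ} {T : ℝ} (hT : 0 < T) (hρ : Continuous ρ)
    (hper : Function.Periodic ρ T) (hnonneg : ∀ x, 0 ≤ ρ x) (hne : ρ ≠ 0) :
    0 < ∫ x in (0 : ℝ)..T, ρ x := by
  obtain ⟨x, hx⟩ := Function.ne_iff.1 hne
  obtain ⟨y, hy, hxy⟩ := hper.exists_mem_Ico₀ hT x
  exact intervalIntegral.integral_pos hT hρ.continuousOn (fun x _ => hnonneg x)
    ⟨y, Ico_subset_Icc_self hy, (hnonneg y).lt_of_ne' (hxy ▸ hx)⟩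

/-- Existence and uniqueness of the normalized groundstate of the Fokker–Planck operator
`L*ρ = ∂_θ(∂_θ(p·ρ) − q·ρ)` on `S¹_π`: if the π-periodic diffusion coefficient `p ≥ 0` is
either everywhere positive, or vanishes at exactly one point `θ̂` of the period `[0,π)` where
the drift satisfies `q(θ̂) ≠ 0`, then there is exactly one smooth, nonnegative, π-periodic
`ρ` with `∫₀^π ρ = 1` and `L*ρ = 0`. -/
theorem fokkerPlanck_groundstate_existsUnique
    (p q : ℝ → ℝ)
    (hp : ContDiff ℝ (⊤ : ℕ∞) p) (hq : ContDiff ℝ (⊤ : ℕ∞) q)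
    (hpper : Function.Periodic p Real.pi) (hqper : Function.Periodic q Real.pi)
    (hpnonneg : ∀ θ, 0 ≤ p θ)
    (hcase : (∀ θ, 0 < p θ) ∨
      (∃ θhat : ℝ, θhat ∈ Set.Ico 0 Real.pi ∧ p θhat = 0 ∧ q θhat ≠ 0 ∧
        ∀ θ ∈ Set.Ico (0:ℝ) Real.pi, p θ = 0 → θ = θhat)) :
    ∃! ρ : ℝ → ℝ,
      ContDiff ℝ (⊤ : ℕ∞) ρ ∧ Function.Periodic ρ Real.pi ∧ (∀ θ, 0 ≤ ρ θ) ∧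
      (∫ θ in (0:ℝ)..Real.pi, ρ θ) = 1 ∧
      ∀ θ : ℝ, deriv (fun x => deriv (fun y => p y * ρ y) x - q x * ρ x) θ = 0 := by
  have hray : HasGroundstateRay p q := by
    rcases hcase with hpos | ⟨t, -, hpt, hqt, huniq⟩
    · exact hasGroundstateRay_of_pos hp hq hpper hqper hpos
    · exact hasGroundstateRay_of_degenerate hp hq hpper hqper hpnonneg hpt hqt huniq
  obtain ⟨⟨t, hu⟩, ρ, hρ, hρ0, hρne⟩ := hray
  have hI := integral_pos_of_periodic Real.pi_pos hρ.1.continuous hρ.2.1 hρ0 hρne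
  set I := ∫ θ in (0:ℝ)..Real.pi, ρ θ
  have hscaled : IsStationaryDensity p q (fun x => I⁻¹ * ρ x) := by
    simpa using hρ.linear_comb hρ I⁻¹ 0
  refine ⟨fun x => I⁻¹ * ρ x, ?_, ?_⟩
  · obtain ⟨h1, h2, h3⟩ := (isStationaryDensity_iff hp hq).1 hscaled
    refine ⟨h1, h2, fun θ => mul_nonneg (inv_nonneg.2 hI.le) (hρ0 θ), ?_, h3⟩
    rw [intervalIntegral.integral_const_mul]
    exact inv_mul_cancel₀ hI.ne'
  · rintro τ ⟨h1, h2, -, h4, h5⟩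
    have hτ : IsStationaryDensity p q τ := (isStationaryDensity_iff hp hq).2 ⟨h1, h2, h5⟩
    have hρt : ρ t ≠ 0 := fun h => hρne (hu ρ hρ h)
    have hτρ : ∀ x, τ x = τ t / ρ t * ρ x := fun x => by
      have := congrFun (hu _ (hτ.linear_comb hρ (ρ t) (τ t)) (by ring)) x
      simp only [Pi.zero_apply] at this
      field_simp
      linarith
    have hone : τ t / ρ t * I = 1 := by
      rw [← h4, ← intervalIntegral.integral_const_mul]
      exact intervalIntegral.integral_congr fun x _ => (hτρ x).symm
    ext x
    rw [hτρ x, eq_inv_of_mul_eq_one_left hone]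
end
end

section
/- Assume P satisfies power-law ψ-mixing with exponent α > 0. Fix λ > 0 and suppose there are E₀ < E₁ and γ₀ > 0 such that γ_λ(E) ≥ γ₀ for every E ∈ (E₀,E₁). Let U = {E ∈ ℂ : E₀ ≤ Re(E) ≤ E₁ and |Im(E)| ≤ 1}. Then there exist a constant Ĉ > 0 and N₀ ∈ ℕ such that for every E ∈ U and every N ≥ N₀ one has P({ ω ∈ Ω : max_{1≤n≤N} ‖T^E_ω(n)‖² ≥ e^{Ĉ·N^{1/2}} }) ≥ 1 − e^{−Ĉ·N^{1/2}}, where T^E_ω(n) = T^E_{λ,S^{n−1}ω}·T^E_{λ,S^{n−2}ω}⋯T^E_{λ,Sω} for n ≥ 2 and T^E_ω(1) is the identity matrix. -/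
open MeasureTheory Filter

noncomputable section

attribute [local instance] Matrix.normedAddCommGroup Matrix.normedSpace

/-- The shift by `n` on the configuration space `Σ^ℤ`: `(shiftn n ω) i = ω (i + n)`.
`shiftn 1` is the left shift `S`. -/
def shiftn {A : Type*} (n : ℤ) (ω : ℤ → A) : ℤ → A := fun i => ω (i + n)

/-- A bounded function `g` on `Σ^ℤ` is quasi-local with rate `r` if its variation on the
window `[-m, n]` is bounded by `C(g) · r^(min m n)` for all `m, n ≥ 1`. -/
def QuasiLocal {A : Type*} {E : Type*} [SeminormedAddGroup E] (r : ℝ)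
    (g : (ℤ → A) → E) : Prop :=
  ∃ C : ℝ, ∀ m n : ℕ, 1 ≤ m → 1 ≤ n → ∀ ω ω' : ℤ → A,
    (∀ i : ℤ, -(m : ℤ) ≤ i → i ≤ (n : ℤ) → ω i = ω' i) →
    ‖g ω - g ω'‖ ≤ C * r ^ (min m n)

/-- Power-law ψ-mixing with exponent α: for all `k < l < m < n`, all bounded `g₁` measurable
w.r.t. the coordinates in `[k,l]` and bounded `g₂` measurable w.r.t. the coordinates in `[m,n]`,
`|E(g₁g₂) − E(g₁)E(g₂)| ≤ C·E(|g₁|)·E(|g₂|)·|m−l|^(−α)`. -/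
def PowerMixing {A : Type*} [MeasurableSpace A] (P : Measure (ℤ → A)) (α : ℝ) : Prop :=
  ∃ C : ℝ, ∀ k l m n : ℤ, k < l → l < m → m < n →
    ∀ g₁ g₂ : (ℤ → A) → ℝ, Measurable g₁ → Measurable g₂ →
      (∃ B, ∀ ω, |g₁ ω| ≤ B) → (∃ B, ∀ ω, |g₂ ω| ≤ B) →
      (∀ ω ω', (∀ i : ℤ, k ≤ i → i ≤ l → ω i = ω' i) → g₁ ω = g₁ ω') →
      (∀ ω ω', (∀ i : ℤ, m ≤ i → i ≤ n → ω i = ω' i) → g₂ ω = g₂ ω') →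
      |(∫ ω, g₁ ω * g₂ ω ∂P) - (∫ ω, g₁ ω ∂P) * ∫ ω, g₂ ω ∂P| ≤
        C * (∫ ω, |g₁ ω| ∂P) * (∫ ω, |g₂ ω| ∂P) * (|(m : ℝ) - (l : ℝ)|) ^ (-α)

/-- The transfer matrix `T^E_{λ,ω} = [[E − λV(ω), −1],[1, 0]]`. -/
def transferMat {A : Type*} (lam : ℝ) (V : (ℤ → A) → ℝ) (E : ℂ) (ω : ℤ → A) :
    Matrix (Fin 2) (Fin 2) ℂ :=
  !![E - (lam : ℂ) * (V ω : ℂ), -1; 1, 0]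

/-- The product `T^E_{λ,S^Nω} ⋯ T^E_{λ,S²ω} T^E_{λ,Sω}` of transfer matrices. -/
def transferProd {A : Type*} (lam : ℝ) (V : (ℤ → A) → ℝ) (E : ℂ) :
    ℕ → (ℤ → A) → Matrix (Fin 2) (Fin 2) ℂ
  | 0, _ => 1
  | n + 1, ω => transferMat lam V E (shiftn (n + 1) ω) * transferProd lam V E n ω

/-- `γ` is the Lyapunov exponent at energy `E`:
`γ = lim_{N→∞} (1/N)·E log‖T^E_{λ,S^Nω}⋯T^E_{λ,Sω}‖`. -/
def IsLyapunov {A : Type*} [MeasurableSpace A] (P : Measure (ℤ → A)) (lam : ℝ)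
    (V : (ℤ → A) → ℝ) (E : ℂ) (γ : ℝ) : Prop :=
  Tendsto (fun N : ℕ => (N : ℝ)⁻¹ * ∫ ω, Real.log ‖transferProd lam V E N ω‖ ∂P)
    atTop (nhds γ)

/-- The spectral density `D_V(k) = Σ_{n∈ℤ} e^{ikn} E(V·(V∘S^n))`. -/
def specDensity {A : Type*} [MeasurableSpace A] (P : Measure (ℤ → A))
    (V : (ℤ → A) → ℝ) (k : ℝ) : ℂ :=
  ∑' n : ℤ, Complex.exp (Complex.I * (k : ℂ) * (n : ℂ)) *
    ((∫ ω, V ω * V (shiftn n ω) ∂P : ℝ) : ℂ)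

/-- The distance from `k` to the nearest point of `(π/2)·ℤ`. -/
def distHalfPi (k : ℝ) : ℝ := ⨅ j : ℤ, |k - Real.pi / 2 * (j : ℝ)|

lemma Matrix.norm_mul_le_two_mul (M N : Matrix (Fin 2) (Fin 2) ℂ) :
    ‖M * N‖ ≤ 2 * ‖M‖ * ‖N‖ := by
  rw [Matrix.norm_le_iff (by positivity)]
  intro i j
  rw [Matrix.mul_apply, Fin.sum_univ_two]
  refine (norm_add_le _ _).trans ?_
  rw [norm_mul, norm_mul]
  have h : ∀ k, ‖M i k‖ * ‖N k j‖ ≤ ‖M‖ * ‖N‖ := fun k => by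
    gcongr <;> exact Matrix.norm_entry_le_entrywise_sup_norm _
  linarith [h 0, h 1]

lemma Matrix.norm_adjugate_le (M : Matrix (Fin 2) (Fin 2) ℂ) : ‖M.adjugate‖ ≤ ‖M‖ := by
  rw [Matrix.norm_le_iff (norm_nonneg _), Matrix.adjugate_fin_two]
  have h : ∀ i j, ‖M i j‖ ≤ ‖M‖ := fun i j => Matrix.norm_entry_le_entrywise_sup_norm _
  intro i j
  fin_cases i <;> fin_cases j <;> simp [h]

lemma Matrix.one_le_two_mul_norm_sq {M : Matrix (Fin 2) (Fin 2) ℂ} (hM : M.det = 1) :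
    1 ≤ 2 * ‖M‖ ^ 2 := by
  have h : ∀ i j, ‖M i j‖ ≤ ‖M‖ := fun i j => Matrix.norm_entry_le_entrywise_sup_norm _
  rw [Matrix.det_fin_two] at hM
  have h1 : ‖M 0 0 * M 1 1 - M 0 1 * M 1 0‖ ≤ ‖M‖ * ‖M‖ + ‖M‖ * ‖M‖ := by
    refine (norm_sub_le _ _).trans ?_
    rw [norm_mul, norm_mul]
    gcongr <;> exact h _ _
  rw [hM, norm_one] at h1
  linarith

section Cocycle

variable {A : Type*} (lam : ℝ) (V : (ℤ → A) → ℝ) (E : ℂ)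

lemma shiftn_shiftn (a b : ℤ) (ω : ℤ → A) : shiftn a (shiftn b ω) = shiftn (a + b) ω := by
  funext i
  simp [shiftn, add_assoc]

lemma det_transferProd (n : ℕ) (ω : ℤ → A) : (transferProd lam V E n ω).det = 1 := by
  induction n with
  | zero => simp [transferProd]
  | succ n ih =>
    rw [transferProd, Matrix.det_mul, ih]
    simp [transferMat, Matrix.det_fin_two]

lemma transferProd_add (b n : ℕ) (ω : ℤ → A) :
    transferProd lam V E (b + n) ω =
      transferProd lam V E n (shiftn b ω) * transferProd lam V E b ω := by
  induction n with
  | zero => simp [transferProd]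
  | succ n ih =>
    rw [← add_assoc, transferProd, transferProd, ih, Matrix.mul_assoc, shiftn_shiftn]
    congr 3
    push_cast
    ring

lemma norm_transferProd_shift_le (b n : ℕ) (ω : ℤ → A) :
    ‖transferProd lam V E n (shiftn b ω)‖ ≤
      2 * ‖transferProd lam V E (b + n) ω‖ * ‖transferProd lam V E b ω‖ := by
  have h : transferProd lam V E n (shiftn b ω) =
      transferProd lam V E (b + n) ω * (transferProd lam V E b ω).adjugate := by
    rw [transferProd_add, Matrix.mul_assoc, Matrix.mul_adjugate, det_transferProd]
    simp
  rw [h]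
  refine (Matrix.norm_mul_le_two_mul _ _).trans ?_
  gcongr
  exact Matrix.norm_adjugate_le _

lemma one_lt_two_mul_norm_transferProd (n : ℕ) (ω : ℤ → A) :
    1 < 2 * ‖transferProd lam V E n ω‖ := by
  have h := Matrix.one_le_two_mul_norm_sq (det_transferProd lam V E n ω)
  by_contra! h1
  nlinarith [norm_nonneg (transferProd lam V E n ω)]

variable {lam V E}

lemma norm_transferMat_le {K : ℝ} (hK1 : 1 ≤ K) {ω : ℤ → A}
    (hK : ‖E - (lam : ℂ) * (V ω : ℂ)‖ ≤ K) : ‖transferMat lam V E ω‖ ≤ K := by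
  rw [Matrix.norm_le_iff (by linarith)]
  intro i j
  fin_cases i <;> fin_cases j <;> simp [transferMat] <;> first | exact hK | linarith

lemma norm_transferProd_le {K : ℝ} (hK1 : 1 ≤ K)
    (hK : ∀ ω, ‖E - (lam : ℂ) * (V ω : ℂ)‖ ≤ K) (n : ℕ) (ω : ℤ → A) :
    ‖transferProd lam V E n ω‖ ≤ (2 * K) ^ n := by
  induction n with
  | zero =>
    rw [transferProd, Matrix.norm_le_iff (by positivity)]
    intro i j
    fin_cases i <;> fin_cases j <;> simp
  | succ n ih =>
    rw [transferProd, pow_succ']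
    refine (Matrix.norm_mul_le_two_mul _ _).trans ?_
    gcongr
    exact norm_transferMat_le hK1 (hK _)

lemma norm_transferProd_sub_le {W : (ℤ → A) → ℝ} {K ε : ℝ} (hK1 : 1 ≤ K) (hlam : 0 ≤ lam)
    (hK : ∀ ω, ‖E - (lam : ℂ) * (V ω : ℂ)‖ ≤ K) (hKW : ∀ ω, ‖E - (lam : ℂ) * (W ω : ℂ)‖ ≤ K)
    (hε : ∀ ω, |V ω - W ω| ≤ ε) (n : ℕ) (ω : ℤ → A) :
    ‖transferProd lam V E n ω - transferProd lam W E n ω‖ ≤ n * (2 * K) ^ n * (lam * ε) := by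
  have hε0 : 0 ≤ lam * ε := mul_nonneg hlam ((abs_nonneg _).trans (hε ω))
  induction n with
  | zero => simp [transferProd]
  | succ n ih =>
    have hsplit : transferProd lam V E (n + 1) ω - transferProd lam W E (n + 1) ω =
        transferMat lam V E (shiftn (n + 1) ω) *
          (transferProd lam V E n ω - transferProd lam W E n ω) +
        (transferMat lam V E (shiftn (n + 1) ω) - transferMat lam W E (shiftn (n + 1) ω)) *
          transferProd lam W E n ω := by
      simp only [transferProd]
      noncomm_ring
    have hmat : ‖transferMat lam V E (shiftn (n + 1) ω) -
        transferMat lam W E (shiftn (n + 1) ω)‖ ≤ lam * ε := by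
      rw [Matrix.norm_le_iff hε0]
      intro i j
      fin_cases i <;> fin_cases j <;> simp [transferMat, hε0]
      rw [← mul_sub, norm_mul, ← Complex.ofReal_sub, Complex.norm_real, Complex.norm_real,
        Real.norm_eq_abs, Real.norm_eq_abs, abs_of_nonneg hlam, abs_sub_comm]
      exact mul_le_mul_of_nonneg_left (hε _) hlam
    rw [hsplit]
    calc _ ≤ 2 * K * (n * (2 * K) ^ n * (lam * ε)) + 2 * (lam * ε) * (2 * K) ^ n := by
          refine (norm_add_le _ _).trans (add_le_add ?_ ?_)
          · refine (Matrix.norm_mul_le_two_mul _ _).trans ?_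
            gcongr
            exact norm_transferMat_le hK1 (hK _)
          · refine (Matrix.norm_mul_le_two_mul _ _).trans ?_
            gcongr
            exact norm_transferProd_le hK1 hKW n ω
      _ ≤ _ := by
          have : 0 ≤ (K - 1) * ((2 * K) ^ n * (lam * ε)) :=
            mul_nonneg (by linarith) (by positivity)
          push_cast
          rw [pow_succ]
          nlinarith

end Cocycle

lemma Polynomial.norm_eval_re_le {Q : Polynomial ℂ} (hQ : ∀ z : ℂ, z.im ≠ 0 → Q.eval z ≠ 0)
    (z : ℂ) : ‖Q.eval (z.re : ℂ)‖ ≤ ‖Q.eval z‖ := by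
  have hs := IsAlgClosed.splits Q
  have hroot : ∀ w ∈ Q.roots, w.im = 0 := fun w hw => by
    by_contra h
    exact hQ w h (Polynomial.isRoot_of_mem_roots hw)
  have key : ∀ x, ‖Q.eval x‖ = ‖Q.leadingCoeff‖ * (Q.roots.map (fun w => ‖x - w‖)).prod := by
    intro x
    rw [hs.eval_eq_prod_roots, norm_mul]
    congr 1
    rw [← normHom_apply, map_multiset_prod, Multiset.map_map]
    rfl
  rw [key, key]
  gcongr
  refine Multiset.prod_map_le_prod_map₀ _ _ (fun _ _ => norm_nonneg _) fun w hw => ?_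
  have h1 : (z.re : ℂ) - w = ((z - w).re : ℂ) := by
    apply Complex.ext <;> simp [hroot w hw]
  rw [h1, Complex.norm_real, Real.norm_eq_abs]
  exact Complex.abs_re_le_norm _

section RealRooted

variable {A : Type*} (lam : ℝ) (V : (ℤ → A) → ℝ)

lemma exists_polynomial_eval_transferProd (n : ℕ) (ω : ℤ → A) :
    ∃ Q : Fin 2 → Fin 2 → Polynomial ℂ,
      ∀ z i j, transferProd lam V z n ω i j = (Q i j).eval z := by
  induction n with
  | zero =>
    refine ⟨fun i j => Polynomial.C ((1 : Matrix (Fin 2) (Fin 2) ℂ) i j), fun z i j => ?_⟩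
    simp [transferProd]
  | succ n ih =>
    obtain ⟨Q, hQ⟩ := ih
    refine ⟨![fun j => (Polynomial.X - Polynomial.C ((lam : ℂ) * (V (shiftn (n + 1) ω) : ℂ))) *
      Q 0 j - Q 1 j, Q 0], fun z i j => ?_⟩
    fin_cases i <;>
      simp [transferProd, transferMat, Matrix.mul_apply, Fin.sum_univ_two, hQ, sub_eq_add_neg]

lemma transferProd_succ_zero (z : ℂ) (n : ℕ) (ω : ℤ → A) (j : Fin 2) :
    transferProd lam V z (n + 1) ω 0 j =
      (z - (lam : ℂ) * (V (shiftn (n + 1) ω) : ℂ)) * transferProd lam V z n ω 0 j -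
        transferProd lam V z n ω 1 j := by
  simp [transferProd, transferMat, Matrix.mul_apply, Fin.sum_univ_two, sub_eq_add_neg]

lemma transferProd_succ_one (z : ℂ) (n : ℕ) (ω : ℤ → A) (j : Fin 2) :
    transferProd lam V z (n + 1) ω 1 j = transferProd lam V z n ω 0 j := by
  simp [transferProd, transferMat, Matrix.mul_apply, Fin.sum_univ_two]

/-- Off the real axis, the ratio of the two entries of a column of the transfer matrix stays in the
half plane of `z`. -/
lemma transferProd_zero_ne_zero_of_le {z : ℂ} (hz : z.im ≠ 0) (ω : ℤ → A) (j : Fin 2) {m n : ℕ}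
    (hmn : m ≤ n) (hm : transferProd lam V z m ω 0 j ≠ 0)
    (hm' : 0 ≤ z.im * (transferProd lam V z m ω 0 j *
      (starRingEnd ℂ) (transferProd lam V z m ω 1 j)).im) :
    transferProd lam V z n ω 0 j ≠ 0 ∧ 0 ≤ z.im * (transferProd lam V z n ω 0 j *
      (starRingEnd ℂ) (transferProd lam V z n ω 1 j)).im := by
  induction n, hmn using Nat.le_induction with
  | base => exact ⟨hm, hm'⟩
  | succ n _ ih =>
    obtain ⟨h1, h2⟩ := ih
    have hrec : z.im * (transferProd lam V z (n + 1) ω 0 j *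
        (starRingEnd ℂ) (transferProd lam V z (n + 1) ω 1 j)).im =
        z.im ^ 2 * Complex.normSq (transferProd lam V z n ω 0 j) +
        z.im * (transferProd lam V z n ω 0 j *
          (starRingEnd ℂ) (transferProd lam V z n ω 1 j)).im := by
      rw [transferProd_succ_zero, transferProd_succ_one, Complex.normSq_apply]
      simp
      ring
    have hpos : 0 < z.im ^ 2 * Complex.normSq (transferProd lam V z n ω 0 j) :=
      mul_pos (by positivity) (Complex.normSq_pos.2 h1)
    refine ⟨fun h0 => ?_, by rw [hrec]; linarith⟩
    rw [h0] at hrec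
    simp only [zero_mul, Complex.zero_im, mul_zero] at hrec
    linarith

lemma transferProd_succ_zero_ne_zero {z : ℂ} (hz : z.im ≠ 0) (ω : ℤ → A) (j : Fin 2) (n : ℕ) :
    transferProd lam V z (n + 1) ω 0 j ≠ 0 := by
  fin_cases j
  · exact (transferProd_zero_ne_zero_of_le lam V hz ω 0 (Nat.zero_le _)
      (by simp [transferProd]) (by simp [transferProd])).1
  · exact (transferProd_zero_ne_zero_of_le lam V hz ω 1 (Nat.le_add_left 1 n)
      (by rw [transferProd_succ_zero]; simp [transferProd])
      (by rw [transferProd_succ_one]; simp [transferProd])).1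

lemma norm_transferProd_re_zero_le (z : ℂ) (n : ℕ) (ω : ℤ → A) (j : Fin 2) :
    ‖transferProd lam V (z.re : ℂ) n ω 0 j‖ ≤ ‖transferProd lam V z n ω 0 j‖ := by
  obtain _ | n := n
  · exact le_rfl
  obtain ⟨Q, hQ⟩ := exists_polynomial_eval_transferProd lam V (n + 1) ω
  rw [hQ, hQ]
  refine Polynomial.norm_eval_re_le (fun w hw => ?_) z
  rw [← hQ]
  exact transferProd_succ_zero_ne_zero lam V hw ω j n

/-- The entries of the transfer matrices are real-rooted polynomials in the energy, so their
modulus decreases when the energy is projected to the real axis. -/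
lemma norm_transferProd_re_le (z : ℂ) (n : ℕ) (ω : ℤ → A) :
    ‖transferProd lam V (z.re : ℂ) n ω‖ ≤ ‖transferProd lam V z n ω‖ := by
  rw [Matrix.norm_le_iff (norm_nonneg _)]
  intro i j
  refine le_trans ?_ (Matrix.norm_entry_le_entrywise_sup_norm _ (i := i) (j := j))
  fin_cases i
  · exact norm_transferProd_re_zero_le lam V z n ω j
  · obtain _ | n := n
    · exact le_rfl
    · simpa [transferProd_succ_one] using norm_transferProd_re_zero_le lam V z n ω j

lemma continuous_norm_transferProd (n : ℕ) (ω : ℤ → A) :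
    Continuous fun x : ℝ => ‖transferProd lam V (x : ℂ) n ω‖ := by
  obtain ⟨Q, hQ⟩ := exists_polynomial_eval_transferProd lam V n ω
  have h : (fun x : ℝ => transferProd lam V (x : ℂ) n ω) =
      fun x : ℝ => (Matrix.of fun i j => (Q i j).eval (x : ℂ)) := by
    funext x
    ext i j
    exact hQ _ _ _
  have hc : Continuous fun x : ℝ => transferProd lam V (x : ℂ) n ω := by
    rw [h]
    exact continuous_matrix fun i j => (Q i j).continuous.comp Complex.continuous_ofReal
  exact hc.norm

end RealRooted

section Measurable

variable {A : Type*} [MeasurableSpace A]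

lemma measurable_shiftn (n : ℤ) : Measurable (shiftn n : (ℤ → A) → ℤ → A) :=
  measurable_pi_iff.2 fun i => measurable_pi_apply (i + n)

lemma MeasureTheory.MeasurePreserving.shiftn_natCast {P : Measure (ℤ → A)}
    (hinv : MeasurePreserving (shiftn 1) P P) (n : ℕ) :
    MeasurePreserving (shiftn (n : ℤ)) P P := by
  induction n with
  | zero =>
    have h : (shiftn ((0 : ℕ) : ℤ) : (ℤ → A) → ℤ → A) = id := by
      funext ω i
      simp [shiftn]
    rw [h]
    exact MeasurePreserving.id P
  | succ n ih =>
    have h : (shiftn ((n + 1 : ℕ) : ℤ) : (ℤ → A) → ℤ → A) = shiftn 1 ∘ shiftn (n : ℤ) := by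
      funext ω
      rw [Function.comp_apply, shiftn_shiftn]
      congr 1
      push_cast
      ring
    rw [h]
    exact hinv.comp ih

lemma measurable_transferProd_apply (lam : ℝ) {V : (ℤ → A) → ℝ} (hV : Measurable V) (E : ℂ)
    (n : ℕ) (i j : Fin 2) : Measurable fun ω => transferProd lam V E n ω i j := by
  induction n generalizing i with
  | zero => simp [transferProd]
  | succ n ih =>
    fin_cases i
    · simp only [Fin.zero_eta, transferProd_succ_zero]
      have := hV.comp (measurable_shiftn (A := A) (n + 1))
      have hc : Measurable fun ω => (V (shiftn (n + 1) ω) : ℂ) :=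
        Complex.measurable_ofReal.comp this
      exact ((measurable_const.sub (measurable_const.mul hc)).mul (ih 0)).sub (ih 1)
    · simp only [Fin.mk_one, transferProd_succ_one]
      exact ih 0

lemma measurable_norm_transferProd (lam : ℝ) {V : (ℤ → A) → ℝ} (hV : Measurable V) (E : ℂ)
    (n : ℕ) : Measurable fun ω => ‖transferProd lam V E n ω‖ := by
  have h : Measurable fun ω => (fun i j => transferProd lam V E n ω i j : Fin 2 → Fin 2 → ℂ) :=
    measurable_pi_iff.2 fun i => measurable_pi_iff.2 fun j =>
      measurable_transferProd_apply lam hV E n i j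
  exact h.norm

end Measurable

section LogNorm

variable {A : Type*} {lam K : ℝ} {V : (ℤ → A) → ℝ} {E : ℂ}

lemma log_two_mul_norm_transferProd_nonneg (n : ℕ) (ω : ℤ → A) :
    0 ≤ Real.log (2 * ‖transferProd lam V E n ω‖) :=
  Real.log_nonneg (one_lt_two_mul_norm_transferProd lam V E n ω).le

lemma log_two_mul_norm_transferProd_le (hK1 : 1 ≤ K)
    (hK : ∀ ω, ‖E - (lam : ℂ) * (V ω : ℂ)‖ ≤ K) (n : ℕ) (ω : ℤ → A) :
    Real.log (2 * ‖transferProd lam V E n ω‖) ≤ (n + 1) * Real.log (2 * K) := by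
  have h1 := one_lt_two_mul_norm_transferProd lam V E n ω
  calc _ ≤ Real.log ((2 * K) ^ (n + 1)) := by
        refine Real.log_le_log (by linarith) ?_
        rw [pow_succ']
        have := norm_transferProd_le hK1 hK n ω
        gcongr
        linarith
    _ = _ := by rw [Real.log_pow]; push_cast; ring

end LogNorm

section Lyapunov

variable {A : Type*} [MeasurableSpace A] {P : Measure (ℤ → A)} [IsProbabilityMeasure P]
  {lam K : ℝ} {V : (ℤ → A) → ℝ} {E : ℂ}

lemma integrable_log_two_mul_norm_transferProd (hV : Measurable V) (hK1 : 1 ≤ K)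
    (hK : ∀ ω, ‖E - (lam : ℂ) * (V ω : ℂ)‖ ≤ K) (n : ℕ) :
    Integrable (fun ω => Real.log (2 * ‖transferProd lam V E n ω‖)) P := by
  refine Integrable.of_bound (C := (n + 1) * Real.log (2 * K))
    ((measurable_norm_transferProd lam hV E n).const_mul 2).log.aestronglyMeasurable
    (Eventually.of_forall fun ω => ?_)
  rw [Real.norm_eq_abs, abs_of_nonneg (log_two_mul_norm_transferProd_nonneg n ω)]
  exact log_two_mul_norm_transferProd_le hK1 hK n ω

lemma subadditive_integral_log_transferProd (hinv : MeasurePreserving (shiftn 1) P P)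
    (hV : Measurable V) (hK1 : 1 ≤ K) (hK : ∀ ω, ‖E - (lam : ℂ) * (V ω : ℂ)‖ ≤ K) :
    Subadditive fun n => ∫ ω, Real.log (2 * ‖transferProd lam V E n ω‖) ∂P := by
  intro m n
  have hshift := hinv.shiftn_natCast m
  have hint := fun k => integrable_log_two_mul_norm_transferProd (P := P) hV hK1 hK k
  have hn : ∫ ω, Real.log (2 * ‖transferProd lam V E n ω‖) ∂P =
      ∫ ω, Real.log (2 * ‖transferProd lam V E n (shiftn m ω)‖) ∂P := by
    conv_lhs => rw [← hshift.map_eq]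
    rw [integral_map hshift.measurable.aemeasurable]
    rw [hshift.map_eq]
    exact (hint n).aestronglyMeasurable
  have hint' : Integrable (fun ω => Real.log (2 * ‖transferProd lam V E n (shiftn m ω)‖)) P :=
    hshift.integrable_comp_of_integrable (hint n)
  simp only []
  rw [hn, ← integral_add (hint m) hint']
  refine integral_mono (hint _) ((hint m).add hint') fun ω => ?_
  have h1 := one_lt_two_mul_norm_transferProd lam V E m ω
  have h2 := one_lt_two_mul_norm_transferProd lam V E n (shiftn m ω)
  simp only
  rw [← Real.log_mul (by linarith) (by linarith)]
  refine Real.log_le_log (by linarith [one_lt_two_mul_norm_transferProd lam V E (m + n) ω]) ?_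
  rw [transferProd_add]
  have := Matrix.norm_mul_le_two_mul (transferProd lam V E n (shiftn m ω))
    (transferProd lam V E m ω)
  linarith

lemma mul_le_integral_log_transferProd (hinv : MeasurePreserving (shiftn 1) P P)
    (hV : Measurable V) (hK1 : 1 ≤ K) (hK : ∀ ω, ‖E - (lam : ℂ) * (V ω : ℂ)‖ ≤ K) {γ₀ : ℝ}
    (hγ : ∀ γ, IsLyapunov P lam V E γ → γ₀ ≤ γ) (n : ℕ) :
    n * γ₀ ≤ ∫ ω, Real.log (2 * ‖transferProd lam V E n ω‖) ∂P := by
  have hsub := subadditive_integral_log_transferProd hinv hV hK1 hK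
  have hbdd : BddBelow (Set.range fun n : ℕ =>
      (∫ ω, Real.log (2 * ‖transferProd lam V E n ω‖) ∂P) / n) := by
    refine ⟨0, ?_⟩
    rintro _ ⟨n, rfl⟩
    exact div_nonneg (integral_nonneg fun ω => log_two_mul_norm_transferProd_nonneg n ω)
      (Nat.cast_nonneg n)
  have hlim := hsub.tendsto_lim hbdd
  have hle : γ₀ ≤ hsub.lim := by
    refine hγ _ ?_
    have hlog2 : Tendsto (fun n : ℕ => Real.log 2 / (n : ℝ)) atTop (nhds 0) :=
      tendsto_const_div_atTop_nhds_zero_nat _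
    have h := hlim.sub hlog2
    rw [sub_zero] at h
    refine h.congr fun n => ?_
    have : ∀ ω, Real.log ‖transferProd lam V E n ω‖ =
        Real.log (2 * ‖transferProd lam V E n ω‖) - Real.log 2 := fun ω => by
      have h1 := one_lt_two_mul_norm_transferProd lam V E n ω
      rw [Real.log_mul two_ne_zero (by linarith)]
      ring
    simp only [this]
    rw [integral_sub (integrable_log_two_mul_norm_transferProd hV hK1 hK n)
      (integrable_const _), integral_const]
    simp only [probReal_univ, one_smul]
    ring
  rcases Nat.eq_zero_or_pos n with rfl | hn
  · simpa using integral_nonneg fun ω => log_two_mul_norm_transferProd_nonneg 0 ω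
  · have h := hsub.lim_le_div hbdd hn.ne'
    have hn' : (0 : ℝ) < n := by exact_mod_cast hn
    rw [le_div_iff₀ hn'] at h
    nlinarith

lemma mul_le_integral_log_transferProd_of_mem_Icc (hinv : MeasurePreserving (shiftn 1) P P)
    (hV : Measurable V) (hK1 : 1 ≤ K) {E₀ E₁ : ℝ} (hE : E₀ < E₁)
    (hK : ∀ x ∈ Set.Icc E₀ E₁, ∀ ω, ‖(x : ℂ) - (lam : ℂ) * (V ω : ℂ)‖ ≤ K) {γ₀ : ℝ}
    (hγ : ∀ x : ℝ, E₀ < x → x < E₁ → ∀ γ, IsLyapunov P lam V (x : ℂ) γ → γ₀ ≤ γ) (n : ℕ)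
    {x : ℝ} (hx : x ∈ Set.Icc E₀ E₁) :
    n * γ₀ ≤ ∫ ω, Real.log (2 * ‖transferProd lam V (x : ℂ) n ω‖) ∂P := by
  rw [← closure_Ioo hE.ne] at hx
  refine le_on_closure (f := fun _ => n * γ₀)
    (g := fun x : ℝ => ∫ ω, Real.log (2 * ‖transferProd lam V (x : ℂ) n ω‖) ∂P)
    (s := Set.Ioo E₀ E₁) (fun y hy => ?_) continuousOn_const ?_ hx
  · exact mul_le_integral_log_transferProd hinv hV hK1 (hK y (Set.Ioo_subset_Icc_self hy))
      (hγ y hy.1 hy.2) n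
  · rw [closure_Ioo hE.ne]
    refine continuousOn_of_dominated (bound := fun _ => (n + 1) * Real.log (2 * K))
      (fun y _ => ?_) (fun y hy => Eventually.of_forall fun ω => ?_) (integrable_const _)
      (Eventually.of_forall fun ω => ?_)
    · exact ((measurable_norm_transferProd lam hV y n).const_mul 2).log.aestronglyMeasurable
    · rw [Real.norm_eq_abs, abs_of_nonneg (log_two_mul_norm_transferProd_nonneg n ω)]
      exact log_two_mul_norm_transferProd_le hK1 (hK y hy) n ω
    · refine (Continuous.log (continuous_const.mul (continuous_norm_transferProd lam V n ω))
        fun y => ne_of_gt ?_).continuousOn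
      change 0 < 2 * ‖transferProd lam V (y : ℂ) n ω‖
      linarith [one_lt_two_mul_norm_transferProd lam V (y : ℂ) n ω]

/-- A lower bound on the mean of `log ‖T‖` gives a uniform lower bound on the probability that
`‖T‖` is exponentially large. -/
lemma le_measureReal_exp_le_norm_transferProd (hV : Measurable V) (hK1 : 1 ≤ K)
    (hK : ∀ ω, ‖E - (lam : ℂ) * (V ω : ℂ)‖ ≤ K) {γ₀ : ℝ} {n : ℕ} (hn : 1 ≤ n)
    (hγ : n * γ₀ ≤ ∫ ω, Real.log (2 * ‖transferProd lam V E n ω‖) ∂P) :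
    γ₀ / (4 * Real.log (2 * K)) ≤
      P.real {ω | Real.exp (n * γ₀ / 2) ≤ 2 * ‖transferProd lam V E n ω‖} := by
  set S := {ω | Real.exp (n * γ₀ / 2) ≤ 2 * ‖transferProd lam V E n ω‖} with hS
  have hSm : MeasurableSet S :=
    measurableSet_le measurable_const ((measurable_norm_transferProd lam hV E n).const_mul 2)
  have hlogK : 0 < Real.log (2 * K) := Real.log_pos (by linarith)
  have hn' : (1 : ℝ) ≤ n := by exact_mod_cast hn
  rcases le_or_gt γ₀ 0 with h0 | h0
  · exact (div_nonpos_of_nonpos_of_nonneg h0 (by positivity)).trans measureReal_nonneg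
  have hle : ∫ ω, Real.log (2 * ‖transferProd lam V E n ω‖) ∂P ≤
      ∫ ω, (S.indicator (fun _ => (n + 1) * Real.log (2 * K)) ω + n * γ₀ / 2) ∂P := by
    refine integral_mono (integrable_log_two_mul_norm_transferProd hV hK1 hK n)
      (((integrable_const _).indicator hSm).add (integrable_const _)) fun ω => ?_
    by_cases hω : ω ∈ S
    · simp only [Set.indicator_of_mem hω]
      have := log_two_mul_norm_transferProd_le hK1 hK n ω
      have : 0 ≤ n * γ₀ / 2 := by positivity
      linarith
    · simp only [Set.indicator_of_notMem hω]
      rw [zero_add, Real.log_le_iff_le_exp]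
      · exact (not_le.1 hω).le
      · linarith [one_lt_two_mul_norm_transferProd lam V E n ω]
  rw [integral_add ((integrable_const _).indicator hSm) (integrable_const _),
    integral_indicator_const _ hSm, integral_const] at hle
  simp only [probReal_univ, smul_eq_mul, one_mul] at hle
  rw [div_le_iff₀ (by positivity)]
  have hP : 0 ≤ P.real S := measureReal_nonneg
  have h2 : n * γ₀ ≤ n * (P.real S * (4 * Real.log (2 * K))) := by
    have : 0 ≤ (n - 1) * (P.real S * Real.log (2 * K)) :=
      mul_nonneg (by linarith) (by positivity)
    nlinarith
  exact le_of_mul_le_mul_left h2 (by linarith)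

end Lyapunov

section Truncation

variable {A : Type*}

/-- The configuration which agrees with `ω` on `[-m, m]` and is constantly `a` elsewhere. -/
def truncConf (a : A) (m : ℕ) (ω : ℤ → A) : ℤ → A :=
  fun i => if -(m : ℤ) ≤ i ∧ i ≤ m then ω i else a

lemma measurable_truncConf [MeasurableSpace A] (a : A) (m : ℕ) : Measurable (truncConf a m) := by
  refine measurable_pi_iff.2 fun i => ?_
  unfold truncConf
  split_ifs
  · exact measurable_pi_apply i
  · exact measurable_const

lemma transferProd_truncConf_congr (lam : ℝ) (V : (ℤ → A) → ℝ) (E : ℂ) (a : A) (m n : ℕ)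
    {ω ω' : ℤ → A} (h : ∀ i : ℤ, 1 - (m : ℤ) ≤ i → i ≤ n + m → ω i = ω' i) :
    transferProd lam (fun ω => V (truncConf a m ω)) E n ω =
      transferProd lam (fun ω => V (truncConf a m ω)) E n ω' := by
  induction n with
  | zero => rfl
  | succ n ih =>
    rw [transferProd, transferProd, ih fun i h1 h2 => h i h1 (by push_cast; omega)]
    congr 1
    have hV : truncConf a m (shiftn (n + 1) ω) = truncConf a m (shiftn (n + 1) ω') := by
      funext i
      simp only [truncConf, shiftn]
      split_ifs with hi
      · exact h _ (by omega) (by push_cast; omega)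
      · rfl
    simp only [transferMat, hV]

lemma QuasiLocal.exists_abs_sub_truncConf_le {r : ℝ} (hr : 0 < r) {V : (ℤ → A) → ℝ}
    (hV : QuasiLocal r V) (a : A) :
    ∃ C : ℝ, 0 ≤ C ∧ ∀ m : ℕ, 1 ≤ m → ∀ ω, |V ω - V (truncConf a m ω)| ≤ C * r ^ m := by
  obtain ⟨C, hC⟩ := hV
  refine ⟨|C|, abs_nonneg C, fun m hm ω => ?_⟩
  have h := hC m m hm hm ω (truncConf a m ω) fun i h1 h2 => by simp [truncConf, h1, h2]
  rw [min_self, Real.norm_eq_abs] at h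
  exact h.trans (by gcongr; exact le_abs_self C)

end Truncation

section Mixing

variable {A : Type*} [MeasurableSpace A] {P : Measure (ℤ → A)}

/-- Power-law ψ-mixing with exponent `α` and a given constant `C`. -/
def PowerMixingWith (P : Measure (ℤ → A)) (C α : ℝ) : Prop :=
  ∀ k l m n : ℤ, k < l → l < m → m < n →
    ∀ g₁ g₂ : (ℤ → A) → ℝ, Measurable g₁ → Measurable g₂ →
      (∃ B, ∀ ω, |g₁ ω| ≤ B) → (∃ B, ∀ ω, |g₂ ω| ≤ B) →
      (∀ ω ω', (∀ i : ℤ, k ≤ i → i ≤ l → ω i = ω' i) → g₁ ω = g₁ ω') →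
      (∀ ω ω', (∀ i : ℤ, m ≤ i → i ≤ n → ω i = ω' i) → g₂ ω = g₂ ω') →
      |(∫ ω, g₁ ω * g₂ ω ∂P) - (∫ ω, g₁ ω ∂P) * ∫ ω, g₂ ω ∂P| ≤
        C * (∫ ω, |g₁ ω| ∂P) * (∫ ω, |g₂ ω| ∂P) * (|(m : ℝ) - (l : ℝ)|) ^ (-α)

lemma measureReal_inter_le_of_mixing {C α : ℝ} (hmix : PowerMixingWith P C α)
    {k l m n : ℤ} (hkl : k < l) (hlm : l < m) (hmn : m < n) {G H : Set (ℤ → A)}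
    (hG : MeasurableSet G) (hH : MeasurableSet H)
    (hGloc : ∀ ω ω', (∀ i : ℤ, k ≤ i → i ≤ l → ω i = ω' i) → (ω ∈ G ↔ ω' ∈ G))
    (hHloc : ∀ ω ω', (∀ i : ℤ, m ≤ i → i ≤ n → ω i = ω' i) → (ω ∈ H ↔ ω' ∈ H)) :
    P.real (G ∩ H) ≤ (1 + C * ((m : ℝ) - l) ^ (-α)) * (P.real G * P.real H) := by
  classical
  have hbdd : ∀ S : Set (ℤ → A), ∃ B, ∀ ω, |S.indicator (1 : (ℤ → A) → ℝ) ω| ≤ B := fun S =>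
    ⟨1, fun ω => by by_cases h : ω ∈ S <;> simp [h]⟩
  have h := hmix k l m n hkl hlm hmn (G.indicator 1) (H.indicator 1)
    (measurable_one.indicator hG) (measurable_one.indicator hH) (hbdd G) (hbdd H)
    (fun ω ω' hω => by simp only [Set.indicator_apply, hGloc ω ω' hω]; rfl)
    (fun ω ω' hω => by simp only [Set.indicator_apply, hHloc ω ω' hω]; rfl)
  have habs : ∀ S : Set (ℤ → A), (fun ω => |S.indicator (1 : (ℤ → A) → ℝ) ω|) = S.indicator 1 :=
    fun S => by
      funext ω
      exact abs_of_nonneg (Set.indicator_nonneg (fun _ _ => zero_le_one) ω)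
  have hmul : (fun ω => G.indicator (1 : (ℤ → A) → ℝ) ω * H.indicator 1 ω) =
      (G ∩ H).indicator 1 := by
    rw [Set.inter_indicator_one]
    rfl
  have hml : (0 : ℝ) < m - l := by
    have : (l : ℝ) < m := by exact_mod_cast hlm
    linarith
  rw [hmul, habs, habs, integral_indicator_one (hG.inter hH), integral_indicator_one hG,
    integral_indicator_one hH, abs_of_pos hml] at h
  have := (abs_le.1 h).2
  linarith

variable [IsProbabilityMeasure P]

/-- Under power-law mixing, the probability of simultaneous occurrence of events supported in
windows of length `len` separated by gaps decays geometrically in the number of windows. -/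
lemma measureReal_iInter_le_pow_of_mixing {C α : ℝ} (hmix : PowerMixingWith P C α)
    (hinv : MeasurePreserving (shiftn 1) P P) {m n : ℕ} (hm : 1 ≤ m)
    {G : Set (ℤ → A)} (hG : MeasurableSet G)
    (hGloc : ∀ ω ω', (∀ i : ℤ, 1 - (m : ℤ) ≤ i → i ≤ n + m → ω i = ω' i) → (ω ∈ G ↔ ω' ∈ G))
    {q : ℝ} (hq1 : P.real G ≤ q) (hq : (1 + C * ((m : ℝ) + 1) ^ (-α)) * P.real G ≤ q) (k : ℕ) :
    P.real (⋂ j < k, shiftn ((j * (n + 3 * m) : ℕ) : ℤ) ⁻¹' G) ≤ q ^ k := by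
  have hq0 : 0 ≤ q := measureReal_nonneg.trans hq1
  have hGs : ∀ j : ℕ, MeasurableSet (shiftn (j : ℤ) ⁻¹' G) := fun j => measurable_shiftn _ hG
  have hPs : ∀ j : ℕ, P.real (shiftn (j : ℤ) ⁻¹' G) = P.real G := fun j =>
    (hinv.shiftn_natCast j).measureReal_preimage hG.nullMeasurableSet
  induction k with
  | zero => simp
  | succ k ih =>
    set F := ⋂ j < k, shiftn ((j * (n + 3 * m) : ℕ) : ℤ) ⁻¹' G with hF
    have hsucc : (⋂ j < k + 1, shiftn ((j * (n + 3 * m) : ℕ) : ℤ) ⁻¹' G) =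
        F ∩ shiftn ((k * (n + 3 * m) : ℕ) : ℤ) ⁻¹' G := Set.biInter_lt_succ _ _
    rw [hsucc]
    obtain _ | k := k
    · refine (measureReal_mono Set.inter_subset_right).trans ?_
      rw [hPs]
      simpa using hq1
    have hgap := measureReal_inter_le_of_mixing hmix (P := P)
      (k := 1 - (m : ℤ)) (l := k * (n + 3 * m) + n + m)
      (m := (k + 1) * (n + 3 * m) + 1 - m) (n := (k + 1) * (n + 3 * m) + n + m)
      (by have : (0 : ℤ) ≤ k * (n + 3 * m) := by positivity
          omega)
      (by linarith [Int.natCast_nonneg m]) (by omega) (G := F)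
      (H := shiftn (((k + 1) * (n + 3 * m) : ℕ) : ℤ) ⁻¹' G)
      (MeasurableSet.biInter (Set.to_countable _) fun j _ => hGs _) (hGs _)
      (fun ω ω' hω => by
        simp only [hF, Set.mem_iInter, Set.mem_preimage]
        refine forall₂_congr fun j hj => hGloc _ _ fun i h1 h2 => ?_
        have h0 : (0 : ℤ) ≤ j * (n + 3 * m) := by positivity
        have hjk : (j : ℤ) * (n + 3 * m) ≤ k * (n + 3 * m) := by
          gcongr
          omega
        simp only [shiftn]
        push_cast
        exact hω _ (by linarith) (by linarith))
      (fun ω ω' hω => hGloc _ _ fun i h1 h2 => by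
        simp only [shiftn]
        push_cast
        exact hω _ (by linarith) (by linarith))
    refine hgap.trans ?_
    have hcast : ((((k + 1) * (n + 3 * m) + 1 - m : ℤ) : ℝ) -
        ((k * (n + 3 * m) + n + m : ℤ) : ℝ)) = (m : ℝ) + 1 := by
      push_cast
      ring
    rw [hcast, hPs]
    calc _ = ((1 + C * ((m : ℝ) + 1) ^ (-α)) * P.real G) * P.real F := by ring
      _ ≤ q * q ^ (k + 1) := mul_le_mul hq ih measureReal_nonneg hq0
      _ = _ := by ring

/-- If `‖T_L‖` is large with probability at least `p`, then the transfer matrices up to `N` all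
stay small only with probability geometrically small in the number of disjoint blocks. -/
lemma measureReal_forall_norm_sq_lt_le_pow {C α : ℝ} (hmix : PowerMixingWith P C α)
    (hinv : MeasurePreserving (shiftn 1) P P) {lam : ℝ} {V : (ℤ → A) → ℝ} (hV : Measurable V)
    {E : ℂ} (a : A) {m L : ℕ} (hm : 1 ≤ m)
    (hclose : ∀ ω, ‖transferProd lam V E L ω -
      transferProd lam (fun ω => V (truncConf a m ω)) E L ω‖ ≤ 1)
    {u p s : ℝ} (hp0 : 0 ≤ p) (hp : p ≤ P.real {ω | u ≤ 2 * ‖transferProd lam V E L ω‖})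
    (hC : C * ((m : ℝ) + 1) ^ (-α) ≤ p / 2) (hs : 4 * s + 4 ≤ u) {k N : ℕ}
    (hkN : k * (L + 3 * m) ≤ N) :
    P.real {ω | ∀ n ≤ N, ‖transferProd lam V E n ω‖ ^ 2 < s} ≤ (1 - p / 2) ^ k := by
  set W : (ℤ → A) → ℝ := fun ω => V (truncConf a m ω) with hW
  have hWm : Measurable W := hV.comp (measurable_truncConf a m)
  set G : Set (ℤ → A) := {ω | ‖transferProd lam W E L ω‖ < u / 2 - 1} with hG
  have hGm : MeasurableSet G :=
    measurableSet_lt (measurable_norm_transferProd lam hWm E L) measurable_const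
  have hPG : P.real G ≤ 1 - p := by
    have hSm : MeasurableSet {ω | u ≤ 2 * ‖transferProd lam V E L ω‖} :=
      measurableSet_le measurable_const ((measurable_norm_transferProd lam hV E L).const_mul 2)
    have hsub : G ⊆ {ω | u ≤ 2 * ‖transferProd lam V E L ω‖}ᶜ := fun ω hω hω' => by
      have h1 := norm_sub_norm_le (transferProd lam V E L ω) (transferProd lam W E L ω)
      have h2 := hclose ω
      simp only [hG, Set.mem_ofPred_eq] at hω hω'
      linarith
    have := measureReal_mono (μ := P) hsub
    rw [probReal_compl_eq_one_sub hSm] at this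
    linarith
  have hPG0 : 0 ≤ P.real G := measureReal_nonneg
  refine (measureReal_mono ?_).trans (measureReal_iInter_le_pow_of_mixing hmix hinv hm hGm
    (n := L) (fun ω ω' hω => ?_) (q := 1 - p / 2) (by linarith) (by nlinarith) k)
  · intro ω hω
    simp only [Set.mem_iInter]
    intro j hj
    have hjN : j * (L + 3 * m) + L ≤ N := by nlinarith
    have h1 := hω _ hjN
    have h2 := hω _ (le_of_add_le_left hjN)
    have h3 := norm_transferProd_shift_le lam V E (j * (L + 3 * m)) L ω
    have h4 := hclose (shiftn ((j * (L + 3 * m) : ℕ) : ℤ) ω)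
    rw [norm_sub_rev] at h4
    have h5 := norm_sub_norm_le (transferProd lam W E L (shiftn ((j * (L + 3 * m) : ℕ) : ℤ) ω))
      (transferProd lam V E L (shiftn ((j * (L + 3 * m) : ℕ) : ℤ) ω))
    have h6 := two_mul_le_add_sq ‖transferProd lam V E (j * (L + 3 * m) + L) ω‖
      ‖transferProd lam V E (j * (L + 3 * m)) ω‖
    change ‖transferProd lam W E L (shiftn ((j * (L + 3 * m) : ℕ) : ℤ) ω)‖ < u / 2 - 1
    linarith
  · simp only [hG, Set.mem_ofPred_eq, hW, transferProd_truncConf_congr lam V E a m L hω]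

end Mixing

lemma one_sub_ofReal_le_of_measureReal_le {X : Type*} [MeasurableSpace X] {P : Measure X}
    [IsProbabilityMeasure P] {S T : Set X} {ε : ℝ} (hST : Sᶜ ⊆ T) (hT : P.real T ≤ ε) :
    1 - ENNReal.ofReal ε ≤ P S := by
  rw [tsub_le_iff_right]
  calc 1 = P (S ∪ Sᶜ) := by rw [Set.union_compl_self, measure_univ]
    _ ≤ P S + P Sᶜ := measure_union_le _ _
    _ ≤ P S + P T := by gcongr
    _ ≤ P S + ENNReal.ofReal ε := by
      gcongr
      rw [← ofReal_measureReal]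
      exact ENNReal.ofReal_le_ofReal hT

/-- With uniformly positive Lyapunov exponent on `(E₀,E₁)`, for energies in the strip `U`
the transfer matrix products grow with large probability:
`P(max_{1≤n≤N} ‖T^E_ω(n)‖² ≥ e^{Ĉ√N}) ≥ 1 − e^{−Ĉ√N}`. -/
theorem transfer_growth_probability {A : Type*} [Countable A] [MeasurableSpace A]
    (P : Measure (ℤ → A)) [IsProbabilityMeasure P]
    (hinv : MeasurePreserving (shiftn 1) P P)
    (r : ℝ) (hr : 0 < r) (hr1 : r < 1)
    (V : (ℤ → A) → ℝ) (hVmeas : Measurable V) (hVbdd : ∃ B, ∀ ω, |V ω| ≤ B)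
    (hVql : QuasiLocal r V) (hVcent : ∫ ω, V ω ∂P = 0)
    (α : ℝ) (hα : 0 < α) (hmix : PowerMixing P α)
    (lam : ℝ) (hlam : 0 < lam)
    (E₀ E₁ : ℝ) (hE : E₀ < E₁) (γ₀ : ℝ) (hγ₀ : 0 < γ₀)
    (hlyap : ∀ E : ℝ, E₀ < E → E < E₁ → ∀ γ : ℝ,
      IsLyapunov P lam V ((E : ℝ) : ℂ) γ → γ₀ ≤ γ) :
    ∃ Chat > (0:ℝ), ∃ N₀ : ℕ, ∀ E : ℂ,
      E₀ ≤ E.re → E.re ≤ E₁ → |E.im| ≤ 1 → ∀ N : ℕ, N₀ ≤ N →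
      1 - ENNReal.ofReal (Real.exp (-(Chat * Real.sqrt N))) ≤
        P {ω : ℤ → A | ∃ n : ℕ, 1 ≤ n ∧ n ≤ N ∧
          Real.exp (Chat * Real.sqrt N) ≤ ‖transferProd lam V E (n - 1) ω‖ ^ 2} := by
  obtain ⟨C, hC⟩ := hmix
  obtain ⟨B, hB⟩ := hVbdd
  obtain ⟨ω₀⟩ : Nonempty (ℤ → A) := nonempty_of_isProbabilityMeasure P
  obtain ⟨Cq, hCq0, hCq⟩ := hVql.exists_abs_sub_truncConf_le hr (ω₀ 0)
  set K : ℝ := max 1 (|E₀| + |E₁| + lam * B) with hKdef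
  have hK1 : 1 ≤ K := le_max_left _ _
  have hK : ∀ x ∈ Set.Icc E₀ E₁, ∀ ω, ‖(x : ℂ) - (lam : ℂ) * (V ω : ℂ)‖ ≤ K := by
    intro x hx ω
    refine le_trans ?_ (le_max_right _ _)
    rw [← Complex.ofReal_mul, ← Complex.ofReal_sub, Complex.norm_real, Real.norm_eq_abs]
    have h1 : |x| ≤ |E₀| + |E₁| := (abs_le_max_abs_abs hx.1 hx.2).trans
      (max_le_add_of_nonneg (abs_nonneg _) (abs_nonneg _))
    have h2 : |lam * V ω| ≤ lam * B := by
      rw [abs_mul, abs_of_pos hlam]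
      exact mul_le_mul_of_nonneg_left (hB ω) hlam.le
    exact (abs_sub _ _).trans (add_le_add h1 h2)
  have hlogK : 0 < Real.log (2 * K) := Real.log_pos (by linarith)
  set p : ℝ := γ₀ / (4 * Real.log (2 * K)) with hpdef
  have hp0 : 0 < p := by positivity
  obtain ⟨M, hM1, hM⟩ : ∃ M : ℕ, 1 ≤ M ∧ (2 * K) ^ 2 * r ^ M * (1 + lam * Cq) ≤ 1 := by
    obtain ⟨n, hn⟩ := exists_pow_lt_of_lt_one
      (show 0 < ((2 * K) ^ 2 * (1 + lam * Cq))⁻¹ by positivity) hr1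
    refine ⟨n + 1, by omega, ?_⟩
    have h1 : r ^ (n + 1) ≤ ((2 * K) ^ 2 * (1 + lam * Cq))⁻¹ :=
      (pow_le_pow_of_le_one hr.le hr1.le (Nat.le_succ n)).trans hn.le
    rw [le_inv_comm₀ (by positivity) (by positivity), le_inv_comm₀ (by positivity) (by positivity),
      ← one_div, le_div_iff₀ (by positivity)] at h1
    linarith
  set D : ℕ := 1 + 3 * M with hDdef
  have hD0 : (0 : ℝ) < D := by positivity
  have hclose : ∀ x ∈ Set.Icc E₀ E₁, ∀ L : ℕ, 1 ≤ L → ∀ ω, ‖transferProd lam V (x : ℂ) L ω -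
      transferProd lam (fun ω => V (truncConf (ω₀ 0) (M * L) ω)) (x : ℂ) L ω‖ ≤ 1 := by
    intro x hx L hL ω
    refine (norm_transferProd_sub_le hK1 hlam.le (hK x hx) (fun ω => hK x hx _)
      (fun ω => hCq (M * L) (Nat.mul_pos hM1 hL) ω) L ω).trans ?_
    have hLK : (L : ℝ) ≤ (2 * K) ^ L := by
      have h1 : (L : ℝ) ≤ 2 ^ L := by exact_mod_cast Nat.lt_two_pow_self.le
      refine h1.trans ?_
      gcongr
      linarith
    have hy1 : (2 * K) ^ 2 * r ^ M ≤ 1 := by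
      have : 0 ≤ (2 * K) ^ 2 * r ^ M * (lam * Cq) := by positivity
      linarith
    calc _ ≤ (2 * K) ^ L * (2 * K) ^ L * (lam * (Cq * r ^ (M * L))) := by gcongr
      _ = ((2 * K) ^ 2 * r ^ M) ^ L * (lam * Cq) := by
          rw [mul_pow _ (r ^ M), ← pow_mul, ← pow_mul, mul_comm 2 L, pow_mul (2 * K)]
          ring
      _ ≤ ((2 * K) ^ 2 * r ^ M) * (lam * Cq) := by
          gcongr
          exact pow_le_of_le_one (by positivity) hy1 (by omega)
      _ ≤ 1 := by
          have : 0 ≤ (2 * K) ^ 2 * r ^ M := by positivity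
          linarith
  have hcast : Tendsto (fun L : ℕ => (L : ℝ)) atTop atTop := tendsto_natCast_atTop_atTop
  have hev1 : ∀ᶠ L : ℕ in atTop, C * (((M * L : ℕ) : ℝ) + 1) ^ (-α) ≤ p / 2 := by
    have h1 : Tendsto (fun L : ℕ => ((M * L : ℕ) : ℝ) + 1) atTop atTop := by
      refine tendsto_atTop_mono (fun L => ?_) hcast
      have : (L : ℝ) ≤ ((M * L : ℕ) : ℝ) := by exact_mod_cast Nat.le_mul_of_pos_left L hM1
      linarith
    have h2 := ((tendsto_rpow_neg_atTop hα).comp h1).const_mul C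
    rw [mul_zero] at h2
    exact h2.eventually_le_const (by positivity)
  have hev2 : ∀ᶠ L : ℕ in atTop, 6 ≤ Real.exp (L * (γ₀ / 4)) :=
    (Real.tendsto_exp_atTop.comp (hcast.atTop_mul_const (by positivity))).eventually_ge_atTop 6
  obtain ⟨L₀, hL₀⟩ := eventually_atTop.1
    (hev1.and (hev2.and (eventually_ge_atTop (2 * D))))
  refine ⟨min (γ₀ / 8) (p / (8 * D)), by positivity, L₀ ^ 2, fun E hre0 hre1 _ N hN => ?_⟩
  set c : ℝ := min (γ₀ / 8) (p / (8 * D)) with hcdef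
  have hx : E.re ∈ Set.Icc E₀ E₁ := ⟨hre0, hre1⟩
  set L : ℕ := Nat.sqrt N with hLdef
  obtain ⟨hLmix, hLexp, hLD⟩ := hL₀ L (Nat.le_sqrt'.2 hN)
  have hL1 : 1 ≤ L := by omega
  have hL1' : (1 : ℝ) ≤ L := by exact_mod_cast hL1
  have hsqrt : Real.sqrt N ≤ 2 * L := by
    have h1 : (N : ℝ) ≤ (L + 1) ^ 2 := by exact_mod_cast (Nat.lt_succ_sqrt' N).le
    refine (Real.sqrt_le_iff.2 ⟨by positivity, h1⟩).trans (by linarith)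
  have hLN : L * L ≤ N := Nat.sqrt_le N
  set k : ℕ := (L - 1) / D with hkdef
  have hkL : k * D ≤ L - 1 := Nat.div_mul_le_self _ _
  have hkN : k * (L + 3 * (M * L)) ≤ N - 1 := by
    have h1 : k * (L + 3 * (M * L)) = k * D * L := by rw [hDdef]; ring
    have h2 : k * D * L ≤ (L - 1) * L := Nat.mul_le_mul_right L hkL
    rw [h1]
    rw [Nat.sub_mul, one_mul] at h2
    omega
  have hLk : (L : ℝ) ≤ D * (k + 1) := by
    have h1 : L - 1 < D * (k + 1) := Nat.lt_mul_div_succ _ (by omega)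
    have h2 : L ≤ D * (k + 1) := by omega
    exact_mod_cast h2
  have hLD' : (2 : ℝ) * D ≤ L := by exact_mod_cast hLD
  have hs : 4 * Real.exp (c * Real.sqrt N) + 4 ≤ Real.exp (L * γ₀ / 2) := by
    have h1 : c * Real.sqrt N ≤ L * (γ₀ / 4) := by
      calc c * Real.sqrt N ≤ γ₀ / 8 * (2 * L) := by
            gcongr
            exact min_le_left _ _
        _ = _ := by ring
    have h2 : Real.exp (L * γ₀ / 2) = Real.exp (L * (γ₀ / 4)) ^ 2 := by
      rw [← Real.exp_nat_mul]
      congr 1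
      push_cast
      ring
    have h3 := Real.exp_le_exp.2 h1
    rw [h2]
    nlinarith
  have hprob := le_measureReal_exp_le_norm_transferProd (P := P) hVmeas hK1 (hK _ hx) hL1
    (mul_le_integral_log_transferProd_of_mem_Icc hinv hVmeas hK1 hE hK hlyap L hx)
  have hsmall := measureReal_forall_norm_sq_lt_le_pow hC hinv hVmeas (ω₀ 0)
    (Nat.mul_pos hM1 hL1) (hclose _ hx L hL1) hp0.le hprob hLmix hs hkN
  refine one_sub_ofReal_le_of_measureReal_le ?_ (hsmall.trans ?_)
  · intro ω hω n hn
    simp only [Set.mem_compl_iff, Set.mem_ofPred_eq, not_exists, not_and, not_le] at hω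
    have hN1 : 1 ≤ N := (Nat.mul_pos hL1 hL1).trans_le hLN
    have h1 := hω (n + 1) (by omega) (by omega)
    rw [Nat.add_sub_cancel] at h1
    refine lt_of_le_of_lt ?_ h1
    gcongr
    exact norm_transferProd_re_le lam V E n ω
  · have hp1 : p ≤ 1 := hprob.trans measureReal_le_one
    have h1 : (1 - p / 2) ^ k ≤ Real.exp (-(p / 2)) ^ k := by
      refine pow_le_pow_left₀ (by linarith) ?_ k
      linarith [Real.add_one_le_exp (-(p / 2))]
    refine h1.trans ?_
    rw [← Real.exp_nat_mul, Real.exp_le_exp]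
    have h2 : c * Real.sqrt N ≤ p / (8 * D) * (2 * L) := by
      gcongr
      exact min_le_right _ _
    have h3 : (L : ℝ) / D ≤ 2 * k := by
      rw [div_le_iff₀ hD0]
      linarith
    have h4 : p / (8 * D) * (2 * L) = p / 4 * (L / D) := by
      field_simp
      ring
    have h5 : p / 4 * (L / D) ≤ p / 4 * (2 * k) := by gcongr
    linarith
end
end
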